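/- arXiv:2403.15893 — 6 statements merged into one kernel-verified Lean document; each statement's English description precedes it below -/
import Mathlib

section
/- Let d ≥ 2 and m > 0. For (z₁, z₂) ∈ T₋ × T₊ the integral W_m(z₁,z₂) = (1 / (2(2π)^{d−1})) ∫_{ℝ^{d−1}} exp(−i p·(z₁ − z₂)) / √(|p⃗|² + m²) dp⃗, where p = (√(|p⃗|² + m²), p⃗), converges absolutely; the function W_m so defined is holomorphic on the open set T₋ × T₊ ⊆ ℂ^d × ℂ^d. -/
open Finset Complex MeasureTheory

/-- The Minkowski inner product `x·y = x⁰y⁰ − x¹y¹ − ⋯ − x^{d−1}y^{d−1}` on `ℝ^d`. -/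
noncomputable def minkR (d : ℕ) [NeZero d] (x y : Fin d → ℝ) : ℝ :=
  x 0 * y 0 - ∑ i ∈ Finset.univ.erase 0, x i * y i

/-- The Minkowski inner product extended `ℂ`-bilinearly to `ℂ^d`. -/
noncomputable def minkC (d : ℕ) [NeZero d] (x y : Fin d → ℂ) : ℂ :=
  x 0 * y 0 - ∑ i ∈ Finset.univ.erase 0, x i * y i

/-- The open forward cone `V₊ = {y : y·y > 0, y⁰ > 0}`. -/
def Vplus (d : ℕ) [NeZero d] : Set (Fin d → ℝ) := {y | 0 < minkR d y y ∧ 0 < y 0}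

/-- The past tube `T₋ = {z = x + iy : −y ∈ V₊}`. -/
def Tminus (d : ℕ) [NeZero d] : Set (Fin d → ℂ) :=
  {z | (fun i => -(z i).im) ∈ Vplus d}

/-- The future tube `T₊ = {z = x + iy : y ∈ V₊}`. -/
def Tplus (d : ℕ) [NeZero d] : Set (Fin d → ℂ) :=
  {z | (fun i => (z i).im) ∈ Vplus d}

/-- The on-shell momentum `p = (ω, p⃗)` with `ω = √(|p⃗|² + m²)`. -/
noncomputable def onShell (d : ℕ) [NeZero d] (m : ℝ)
    (pv : EuclideanSpace ℝ (Fin (d - 1))) : Fin d → ℝ :=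
  fun i => if h : (i : ℕ) = 0 then Real.sqrt (‖pv‖ ^ 2 + m ^ 2)
    else pv ⟨(i : ℕ) - 1, by have := i.isLt; omega⟩

/-- The integrand of the plane-wave representation of the two-point function. -/
noncomputable def WmIntegrand (d : ℕ) [NeZero d] (m : ℝ) (z₁ z₂ : Fin d → ℂ)
    (pv : EuclideanSpace ℝ (Fin (d - 1))) : ℂ :=
  Complex.exp (-Complex.I * minkC d (fun i => (onShell d m pv i : ℂ)) (z₁ - z₂)) /
    (Real.sqrt (‖pv‖ ^ 2 + m ^ 2) : ℂ)

/-- The two-point function `W_m` of a Klein–Gordon field of mass `m`. -/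
noncomputable def Wm (d : ℕ) [NeZero d] (m : ℝ) (z₁ z₂ : Fin d → ℂ) : ℂ :=
  (1 / (2 * (2 * Real.pi) ^ (d - 1) : ℝ)) *
    ∫ pv : EuclideanSpace ℝ (Fin (d - 1)), WmIntegrand d m z₁ z₂ pv

section OnShell

variable {d : ℕ} [NeZero d]

/-- The gap `y⁰ − |y⃗|`, which is positive exactly on the open forward cone. -/
noncomputable def coneGap (d : ℕ) [NeZero d] (y : Fin d → ℝ) : ℝ :=
  y 0 - √(∑ i ∈ univ.erase 0, y i ^ 2)

lemma coneGap_pos {y : Fin d → ℝ} (hy : y ∈ Vplus d) : 0 < coneGap d y := by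
  obtain ⟨h1, h2⟩ := hy
  simp only [minkR, ← sq] at h1
  rw [coneGap, sub_pos, Real.sqrt_lt' h2]
  linarith

lemma continuous_coneGap : Continuous (coneGap d) := by
  unfold coneGap
  fun_prop

lemma continuous_onShell (m : ℝ) : Continuous (onShell d m) := by
  refine continuous_pi fun i => ?_
  unfold onShell
  split_ifs <;> fun_prop

lemma onShell_zero (m : ℝ) (pv : EuclideanSpace ℝ (Fin (d - 1))) :
    onShell d m pv 0 = √(‖pv‖ ^ 2 + m ^ 2) := by
  simp [onShell]

lemma sum_sq_onShell (m : ℝ) (pv : EuclideanSpace ℝ (Fin (d - 1))) :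
    ∑ i ∈ univ.erase 0, onShell d m pv i ^ 2 = ‖pv‖ ^ 2 := by
  obtain ⟨n, rfl⟩ := Nat.exists_eq_succ_of_ne_zero (NeZero.ne d)
  rw [← add_right_inj (onShell (n + 1) m pv 0 ^ 2),
    add_sum_erase _ (fun i => onShell (n + 1) m pv i ^ 2) (mem_univ 0), Fin.sum_univ_succ,
    EuclideanSpace.norm_sq_eq]
  simp [onShell]

lemma abs_onShell_le (m : ℝ) (pv : EuclideanSpace ℝ (Fin (d - 1))) (i : Fin d) :
    |onShell d m pv i| ≤ √(‖pv‖ ^ 2 + m ^ 2) := by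
  by_cases hi : i = 0
  · rw [hi, onShell_zero, abs_of_nonneg (Real.sqrt_nonneg _)]
  · refine Real.abs_le_sqrt ?_
    have := single_le_sum (f := fun i => onShell d m pv i ^ 2) (fun i _ => sq_nonneg _)
      (mem_erase.2 ⟨hi, mem_univ i⟩)
    rw [sum_sq_onShell] at this
    nlinarith [sq_nonneg m]

lemma norm_le_sqrt_norm_sq_add_sq {E : Type*} [SeminormedAddCommGroup E] (v : E) (m : ℝ) :
    ‖v‖ ≤ √(‖v‖ ^ 2 + m ^ 2) :=
  Real.le_sqrt_of_sq_le (by nlinarith [sq_nonneg m])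

lemma coneGap_mul_le_minkR_onShell (m : ℝ) (pv : EuclideanSpace ℝ (Fin (d - 1)))
    (y : Fin d → ℝ) :
    coneGap d y * √(‖pv‖ ^ 2 + m ^ 2) ≤ minkR d (onShell d m pv) y := by
  have h := Real.sum_mul_le_sqrt_mul_sqrt (univ.erase 0) (onShell d m pv) y
  rw [sum_sq_onShell, Real.sqrt_sq (norm_nonneg _)] at h
  have h' := mul_le_mul_of_nonneg_right (norm_le_sqrt_norm_sq_add_sq pv m)
    (Real.sqrt_nonneg (∑ i ∈ univ.erase 0, y i ^ 2))
  rw [minkR, coneGap, onShell_zero]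
  linarith

lemma im_minkC_ofReal_sub (x : Fin d → ℝ) (z w : Fin d → ℂ) :
    (minkC d (fun i => (x i : ℂ)) (z - w)).im =
      -(minkR d x (fun i => -(z i).im) + minkR d x (fun i => (w i).im)) := by
  simp only [minkC, minkR, Complex.sub_im, Complex.im_sum, Complex.im_ofReal_mul, Pi.sub_apply,
    mul_sub, sum_sub_distrib, mul_neg, sum_neg_distrib]
  ring

lemma norm_exp_minkC_onShell_le {m c : ℝ} {z w : Fin d → ℂ}
    (hz : c ≤ coneGap d (fun i => -(z i).im)) (hw : 0 ≤ coneGap d (fun i => (w i).im))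
    (hc : 0 ≤ c) (pv : EuclideanSpace ℝ (Fin (d - 1))) :
    ‖exp (-I * minkC d (fun i => (onShell d m pv i : ℂ)) (z - w))‖ ≤ Real.exp (-(c * ‖pv‖)) := by
  rw [norm_exp, Real.exp_le_exp]
  have h : (-I * minkC d (fun i => (onShell d m pv i : ℂ)) (z - w)).re =
      (minkC d (fun i => (onShell d m pv i : ℂ)) (z - w)).im := by simp
  rw [h, im_minkC_ofReal_sub]
  have h0 := Real.sqrt_nonneg (‖pv‖ ^ 2 + m ^ 2)
  have h1 := coneGap_mul_le_minkR_onShell m pv (fun i => -(z i).im)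
  have h2 := coneGap_mul_le_minkR_onShell m pv (fun i => (w i).im)
  have h3 := mul_le_mul_of_nonneg_right hz h0
  have h4 := mul_le_mul_of_nonneg_left (norm_le_sqrt_norm_sq_add_sq pv m) hc
  have h5 := mul_nonneg hw h0
  linarith

lemma sqrt_norm_sq_add_sq_pos {E : Type*} [SeminormedAddCommGroup E] {m : ℝ} (hm : 0 < m)
    (v : E) : 0 < √(‖v‖ ^ 2 + m ^ 2) :=
  Real.sqrt_pos.2 (by positivity)

lemma continuous_WmIntegrand {m : ℝ} (hm : 0 < m) (z w : Fin d → ℂ) :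
    Continuous (WmIntegrand d m z w) := by
  have h := continuous_onShell (d := d) m
  have h' : ∀ i, Continuous fun pv => onShell d m pv i := fun i => (continuous_apply i).comp h
  unfold WmIntegrand minkC
  refine Continuous.div (by fun_prop) (by fun_prop) fun pv => ?_
  exact_mod_cast (sqrt_norm_sq_add_sq_pos hm pv).ne'

lemma integrable_exp_neg_mul_norm {E : Type*} [NormedAddCommGroup E] [NormedSpace ℝ E]
    [FiniteDimensional ℝ E] [MeasurableSpace E] [BorelSpace E] (μ : Measure E)
    [μ.IsAddHaarMeasure] {c : ℝ} (hc : 0 < c) :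
    Integrable (fun v : E => Real.exp (-(c * ‖v‖))) μ := by
  set n := Module.finrank ℝ E + 1 with hn
  have hint : Integrable (fun v : E => (1 + ‖v‖) ^ (-(n : ℝ))) μ :=
    integrable_one_add_norm (by rw [hn]; push_cast; linarith)
  refine (hint.const_mul (Real.exp c * (n.factorial / c ^ n))).mono' (by fun_prop)
    (.of_forall fun v => ?_)
  have hv : 0 < 1 + ‖v‖ := by positivity
  have h := Real.pow_div_factorial_le_exp (c * (1 + ‖v‖)) (by positivity) n
  have hx : Real.exp (-(c * ‖v‖)) = Real.exp c * (Real.exp (c * (1 + ‖v‖)))⁻¹ := by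
    rw [← Real.exp_neg, ← Real.exp_add]
    ring_nf
  rw [Real.norm_of_nonneg (Real.exp_pos _).le, hx, mul_assoc, Real.rpow_neg hv.le,
    Real.rpow_natCast]
  gcongr
  calc (Real.exp (c * (1 + ‖v‖)))⁻¹ ≤ ((c * (1 + ‖v‖)) ^ n / n.factorial)⁻¹ := by gcongr
    _ = n.factorial / c ^ n * ((1 + ‖v‖) ^ n)⁻¹ := by
      rw [inv_div, mul_pow]
      field_simp

lemma integrable_WmIntegrand {m : ℝ} (hm : 0 < m) {z w : Fin d → ℂ}
    (hz : z ∈ Tminus d) (hw : w ∈ Tplus d) : Integrable (WmIntegrand d m z w) := by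
  refine ((integrable_exp_neg_mul_norm volume (coneGap_pos hz)).div_const m).mono'
    (continuous_WmIntegrand hm z w).aestronglyMeasurable (.of_forall fun pv => ?_)
  rw [WmIntegrand, norm_div, norm_real, Real.norm_of_nonneg (Real.sqrt_nonneg _)]
  have := norm_exp_minkC_onShell_le (m := m) le_rfl (coneGap_pos hw).le (coneGap_pos hz).le pv
  have hmω : m ≤ √(‖pv‖ ^ 2 + m ^ 2) := Real.le_sqrt_of_sq_le (by nlinarith [sq_nonneg ‖pv‖])
  gcongr

/-- The `i`-th term `(z₁, z₂) ↦ −i g_{ii} (z₁ − z₂)^i` of the plane-wave exponent. -/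
noncomputable def phaseCoord (i : Fin d) : ((Fin d → ℂ) × (Fin d → ℂ)) →L[ℂ] ℂ :=
  (-I * if i = 0 then 1 else -1) • (ContinuousLinearMap.proj i).comp
    (ContinuousLinearMap.fst ℂ (Fin d → ℂ) (Fin d → ℂ) -
      ContinuousLinearMap.snd ℂ (Fin d → ℂ) (Fin d → ℂ))

/-- The plane-wave exponent `(z₁, z₂) ↦ −i x·(z₁ − z₂)` as a continuous linear map. -/
noncomputable def phase (x : Fin d → ℝ) : ((Fin d → ℂ) × (Fin d → ℂ)) →L[ℂ] ℂ :=
  ∑ i, (x i : ℂ) • phaseCoord i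

lemma phase_apply (x : Fin d → ℝ) (zz : (Fin d → ℂ) × (Fin d → ℂ)) :
    phase x zz = -I * minkC d (fun i => (x i : ℂ)) (zz.1 - zz.2) := by
  rw [phase, _root_.sum_apply, ← add_sum_erase _ _ (mem_univ 0), minkC, mul_sub,
    mul_sum, sub_eq_add_neg, ← sum_neg_distrib]
  congr 1
  · simp [phaseCoord]
    ring
  · refine sum_congr rfl fun i hi => ?_
    simp [phaseCoord, ne_of_mem_erase hi]
    ring

lemma norm_phase_onShell_le (m : ℝ) (pv : EuclideanSpace ℝ (Fin (d - 1))) :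
    ‖phase (onShell d m pv)‖ ≤ √(‖pv‖ ^ 2 + m ^ 2) * ∑ i : Fin d, ‖phaseCoord i‖ := by
  rw [mul_sum]
  refine norm_sum_le_of_le _ fun i _ => ?_
  rw [norm_smul, norm_real, Real.norm_eq_abs]
  gcongr
  exact abs_onShell_le m pv i

lemma continuous_phase_onShell (m : ℝ) : Continuous fun pv => phase (onShell d m pv) := by
  have h' : ∀ i, Continuous fun pv => onShell d m pv i :=
    fun i => (continuous_apply i).comp (continuous_onShell m)
  unfold phase
  fun_prop

lemma hasFDerivAt_WmIntegrand (m : ℝ) (pv : EuclideanSpace ℝ (Fin (d - 1)))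
    (zz : (Fin d → ℂ) × (Fin d → ℂ)) :
    HasFDerivAt (fun zz : (Fin d → ℂ) × (Fin d → ℂ) => WmIntegrand d m zz.1 zz.2 pv)
      (WmIntegrand d m zz.1 zz.2 pv • phase (onShell d m pv)) zz := by
  simp only [WmIntegrand, ← phase_apply, div_eq_inv_mul, mul_smul]
  exact ((phase (onShell d m pv)).hasFDerivAt.cexp).const_mul _

lemma differentiableAt_integral_WmIntegrand {m : ℝ} (hm : 0 < m)
    {zz : (Fin d → ℂ) × (Fin d → ℂ)} (hz : zz.1 ∈ Tminus d) (hw : zz.2 ∈ Tplus d) :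
    DifferentiableAt ℂ (fun zz : (Fin d → ℂ) × (Fin d → ℂ) =>
      ∫ pv, WmIntegrand d m zz.1 zz.2 pv) zz := by
  set c := coneGap d (fun i => -(zz.1 i).im) / 2
  have hz' := coneGap_pos hz
  have hc0 : 0 < c := half_pos hz'
  have hcont₁ : Continuous fun u : (Fin d → ℂ) × (Fin d → ℂ) =>
      coneGap d (fun i => -(u.1 i).im) := continuous_coneGap.comp (by fun_prop)
  have hcont₂ : Continuous fun u : (Fin d → ℂ) × (Fin d → ℂ) =>
      coneGap d (fun i => (u.2 i).im) := continuous_coneGap.comp (by fun_prop)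
  have hnhds := (hcont₁.continuousAt.eventually_const_lt (half_lt_self hz')).and
    (hcont₂.continuousAt.eventually_const_lt (coneGap_pos hw))
  have hbound : ∀ (pv : EuclideanSpace ℝ (Fin (d - 1))) (u : (Fin d → ℂ) × (Fin d → ℂ)),
      (c < coneGap d (fun i => -(u.1 i).im) ∧ 0 < coneGap d (fun i => (u.2 i).im)) →
      ‖WmIntegrand d m u.1 u.2 pv • phase (onShell d m pv)‖ ≤
        Real.exp (-(c * ‖pv‖)) * ∑ i : Fin d, ‖phaseCoord i‖ := by
    intro pv u hu
    have hω := sqrt_norm_sq_add_sq_pos hm pv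
    rw [norm_smul, WmIntegrand, norm_div, norm_real, Real.norm_of_nonneg hω.le]
    calc _ ≤ Real.exp (-(c * ‖pv‖)) / √(‖pv‖ ^ 2 + m ^ 2) *
          (√(‖pv‖ ^ 2 + m ^ 2) * ∑ i : Fin d, ‖phaseCoord i‖) :=
        mul_le_mul (div_le_div_of_nonneg_right
          (norm_exp_minkC_onShell_le hu.1.le hu.2.le hc0.le pv) hω.le)
          (norm_phase_onShell_le m pv) (norm_nonneg _) (by positivity)
      _ = _ := by field_simp
  have hbound_int : Integrable (fun pv : EuclideanSpace ℝ (Fin (d - 1)) =>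
      Real.exp (-(c * ‖pv‖)) * ∑ i : Fin d, ‖phaseCoord i‖) :=
    (integrable_exp_neg_mul_norm volume hc0).mul_const _
  have hmeas : AEStronglyMeasurable (fun pv : EuclideanSpace ℝ (Fin (d - 1)) =>
      WmIntegrand d m zz.1 zz.2 pv • phase (onShell d m pv)) volume :=
    ((continuous_WmIntegrand hm _ _).smul (continuous_phase_onShell m)).aestronglyMeasurable
  exact (hasFDerivAt_integral_of_dominated_of_fderiv_le
    (F := fun (u : (Fin d → ℂ) × (Fin d → ℂ)) pv => WmIntegrand d m u.1 u.2 pv)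
    (F' := fun u pv => WmIntegrand d m u.1 u.2 pv • phase (onShell d m pv)) hnhds
    (.of_forall fun u => (continuous_WmIntegrand hm u.1 u.2).aestronglyMeasurable)
    (integrable_WmIntegrand hm hz hw) hmeas
    (.of_forall hbound) hbound_int
    (.of_forall fun pv u _ => hasFDerivAt_WmIntegrand m pv u)).differentiableAt

end OnShell

/-- For `(z₁, z₂) ∈ T₋ × T₊` the plane-wave integral defining `W_m` converges
absolutely, and `W_m` is holomorphic on `T₋ × T₊`. -/
theorem Wm_integrable_and_holomorphic (d : ℕ) [NeZero d] (hd : 2 ≤ d)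
    (m : ℝ) (hm : 0 < m) :
    (∀ z₁ ∈ Tminus d, ∀ z₂ ∈ Tplus d,
        Integrable (WmIntegrand d m z₁ z₂) volume) ∧
      DifferentiableOn ℂ (fun zz : (Fin d → ℂ) × (Fin d → ℂ) => Wm d m zz.1 zz.2)
        (Tminus d ×ˢ Tplus d) := by
  refine ⟨fun z₁ hz₁ z₂ hz₂ => integrable_WmIntegrand hm hz₁ hz₂, fun zz hzz => ?_⟩
  exact ((differentiableAt_integral_WmIntegrand hm hzz.1 hzz.2).const_mul _).differentiableWithinAt
end

section
/- Let d ≥ 3 be an integer, t ∈ ℝ and s > 0. Then (1 / (2(2π)^{d−1})) ∫_{ℝ^{d−1}} exp(−i |p⃗| (t − is)) / |p⃗| dp⃗ = (1 / (4π)^{(d−1)/2}) · (Γ(d−2) / Γ((d−1)/2)) · (it + s)^{−(d−2)}, where the complex power is the principal branch (well defined since Re(it+s) = s > 0). -/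
open Complex MeasureTheory

/-- Polar coordinates for the integral of a radial function on Euclidean space. -/
theorem integral_radial_euclideanSpace {n : ℕ} (hn : n ≠ 0) (f : ℝ → ℂ) :
    ∫ p : EuclideanSpace ℝ (Fin n), f ‖p‖ =
      ((2 * √Real.pi ^ n / Real.Gamma (n / 2) : ℝ) : ℂ) *
        ∫ r in Set.Ioi (0 : ℝ), (r : ℂ) ^ (n - 1) * f r := by
  have : Nonempty (Fin n) := Fin.pos_iff_nonempty.mp (Nat.pos_of_ne_zero hn)
  have hn' : (0 : ℝ) < n := Nat.cast_pos.mpr (Nat.pos_of_ne_zero hn)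
  have hG : 0 < Real.Gamma ((n : ℝ) / 2) := Real.Gamma_pos_of_pos (by positivity)
  have hvol : (volume : Measure (EuclideanSpace ℝ (Fin n))).real (Metric.ball 0 1) =
      √Real.pi ^ n / Real.Gamma (n / 2 + 1) := by
    rw [Measure.real, EuclideanSpace.volume_ball, Fintype.card_fin, ENNReal.ofReal_one, one_pow,
      one_mul, ENNReal.toReal_ofReal]
    exact div_nonneg (by positivity) (Real.Gamma_pos_of_pos (by positivity)).le
  have hconst : (n : ℝ) * (√Real.pi ^ n / Real.Gamma (n / 2 + 1)) =
      2 * √Real.pi ^ n / Real.Gamma (n / 2) := by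
    rw [Real.Gamma_add_one (by positivity)]
    field_simp
  rw [integral_fun_norm_addHaar, finrank_euclideanSpace_fin, hvol, ← hconst]
  simp only [nsmul_eq_mul, real_smul, ofReal_pow, ofReal_mul, ofReal_natCast, mul_assoc]

theorem norm_pow_mul_exp_neg_mul (m : ℕ) (a : ℂ) {r : ℝ} (hr : 0 < r) :
    ‖(r : ℂ) ^ m * exp (-(a * r))‖ = r ^ (m : ℝ) * Real.exp (-a.re * r) := by
  rw [norm_mul, norm_pow, norm_exp, norm_real, Real.norm_of_nonneg hr.le, Real.rpow_natCast]
  simp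

theorem integrableOn_pow_mul_exp_neg_mul_Ioi (m : ℕ) {a : ℂ} (ha : 0 < a.re) :
    IntegrableOn (fun r : ℝ => (r : ℂ) ^ m * exp (-(a * r))) (Set.Ioi 0) := by
  have h := integrableOn_rpow_mul_exp_neg_mul_rpow (s := m) (p := 1) (b := a.re)
    (neg_one_lt_zero.trans_le m.cast_nonneg) one_pos ha
  simp only [Real.rpow_one] at h
  refine Integrable.mono' h (by fun_prop) ?_
  filter_upwards [ae_restrict_mem measurableSet_Ioi] with r hr
  exact (norm_pow_mul_exp_neg_mul m a hr).le

theorem tendsto_pow_mul_exp_neg_mul_atTop (m : ℕ) {a : ℂ} (ha : 0 < a.re) :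
    Filter.Tendsto (fun r : ℝ => (r : ℂ) ^ m * exp (-(a * r))) Filter.atTop (nhds 0) := by
  rw [tendsto_zero_iff_norm_tendsto_zero]
  refine (tendsto_rpow_mul_exp_neg_mul_atTop_nhds_zero m a.re ha).congr' ?_
  filter_upwards [Filter.eventually_gt_atTop 0] with r hr
  exact (norm_pow_mul_exp_neg_mul m a hr).symm

/-- The Laplace transform of `r ^ m` at a complex argument of positive real part. -/
theorem integral_pow_mul_exp_neg_mul_Ioi (m : ℕ) {a : ℂ} (ha : 0 < a.re) :
    ∫ r in Set.Ioi (0 : ℝ), (r : ℂ) ^ m * exp (-(a * r)) =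
      (Real.Gamma (m + 1) : ℂ) * a ^ (-((m : ℂ) + 1)) := by
  have ha0 : a ≠ 0 := fun h => by simp [h] at ha
  have hfactorial : ∫ r in Set.Ioi (0 : ℝ), (r : ℂ) ^ m * exp (-(a * r)) =
      (m.factorial : ℂ) / a ^ (m + 1) := by
    induction m with
    | zero =>
      have h := integral_exp_mul_complex_Ioi (a := -a) (by simpa using ha) 0
      simpa using h
    | succ m ih =>
      have hderiv : ∀ r ∈ Set.Ici (0 : ℝ),
          HasDerivAt (fun r : ℝ => (r : ℂ) ^ (m + 1) * exp (-(a * r)))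
            ((m + 1) * ((r : ℂ) ^ m * exp (-(a * r))) -
              a * ((r : ℂ) ^ (m + 1) * exp (-(a * r)))) r := by
        intro r _
        have hid : HasDerivAt (fun r : ℝ => (r : ℂ)) 1 r := ofRealCLM.hasDerivAt
        convert! (hid.pow (m + 1)).mul (hid.const_mul a).neg.cexp using 1
        simp only [Pi.pow_apply, Pi.neg_apply, Nat.add_sub_cancel]
        push_cast
        ring
      have hint := (integrableOn_pow_mul_exp_neg_mul_Ioi m ha).const_mul ((m : ℂ) + 1)
      have hint' := (integrableOn_pow_mul_exp_neg_mul_Ioi (m + 1) ha).const_mul a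
      have h := integral_Ioi_of_hasDerivAt_of_tendsto' hderiv (hint.sub hint')
        (tendsto_pow_mul_exp_neg_mul_atTop (m + 1) ha)
      rw [integral_sub hint hint', integral_const_mul, integral_const_mul, ih] at h
      simp only [ofReal_zero, zero_pow (Nat.succ_ne_zero m), zero_mul, sub_zero] at h
      rw [← mul_right_inj' ha0, ← sub_eq_zero.mp h, Nat.factorial_succ]
      push_cast
      rw [pow_succ a (m + 1)]
      field_simp
  rw [hfactorial, Real.Gamma_nat_eq_factorial, cpow_neg, div_eq_mul_inv, ofReal_natCast,
    ← Nat.cast_add_one, cpow_natCast]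

/-- The massless two-point function at `z₁ − z₂ = (t − is, 0, …, 0)`:
`(1/(2(2π)^{d−1})) ∫ exp(−i|p⃗|(t−is))/|p⃗| dp⃗
  = (1/(4π)^{(d−1)/2}) (Γ(d−2)/Γ((d−1)/2)) (it+s)^{−(d−2)}`. -/
theorem massless_two_point_evaluation (d : ℕ) (hd : 3 ≤ d) (t s : ℝ) (hs : 0 < s) :
    (1 / (2 * (2 * Real.pi) ^ (d - 1) : ℝ) : ℂ) *
        ∫ p : EuclideanSpace ℝ (Fin (d - 1)),
          Complex.exp (-Complex.I * (‖p‖ : ℂ) * ((t : ℂ) - (s : ℂ) * Complex.I)) / (‖p‖ : ℂ)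
      = ((1 / (4 * Real.pi) ^ (((d : ℝ) - 1) / 2) : ℝ) : ℂ) *
          ((Real.Gamma ((d : ℝ) - 2) / Real.Gamma (((d : ℝ) - 1) / 2) : ℝ) : ℂ) *
          (Complex.I * (t : ℂ) + (s : ℂ)) ^ (-((d : ℂ) - 2)) := by
  obtain ⟨m, rfl⟩ := Nat.exists_eq_add_of_le' hd
  have hradial : ∫ r in Set.Ioi (0 : ℝ), (r : ℂ) ^ (m + 2 - 1) *
        (exp (-I * (r : ℂ) * ((t : ℂ) - (s : ℂ) * I)) / (r : ℂ)) =
      (Real.Gamma (m + 1) : ℂ) * (I * (t : ℂ) + (s : ℂ)) ^ (-((m : ℂ) + 1)) := by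
    rw [← integral_pow_mul_exp_neg_mul_Ioi m (by simpa using hs)]
    refine setIntegral_congr_fun measurableSet_Ioi fun r hr => ?_
    have hr0 : (r : ℂ) ≠ 0 := ofReal_ne_zero.mpr (ne_of_gt hr)
    have hexp : -I * (r : ℂ) * ((t : ℂ) - (s : ℂ) * I) = -((I * t + s) * r) := by
      linear_combination (r * s : ℂ) * I_sq
    simp only [hexp, show m + 2 - 1 = m + 1 from rfl, pow_succ]
    field_simp
  have hpow : (4 * Real.pi) ^ (((m : ℝ) + 2) / 2) = (2 * √Real.pi) ^ (m + 2) := by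
    have h4 : 4 * Real.pi = (2 * √Real.pi) ^ (2 : ℝ) := by
      rw [Real.rpow_two, mul_pow, Real.sq_sqrt Real.pi_pos.le]
      norm_num
    rw [h4, ← Real.rpow_mul (by positivity), ← Real.rpow_natCast]
    push_cast
    ring_nf
  have hconst : 1 / (2 * (2 * Real.pi) ^ (m + 2)) *
        (2 * √Real.pi ^ (m + 2) / Real.Gamma (((m + 2 : ℕ) : ℝ) / 2)) =
      1 / (4 * Real.pi) ^ (((m : ℝ) + 2) / 2) * (1 / Real.Gamma (((m : ℝ) + 2) / 2)) := by
    have hG : 0 < Real.Gamma (((m : ℝ) + 2) / 2) := Real.Gamma_pos_of_pos (by positivity)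
    have hpi : (2 * Real.pi) ^ (m + 2) = (2 * √Real.pi) ^ (m + 2) * √Real.pi ^ (m + 2) := by
      rw [← mul_pow, mul_assoc, Real.mul_self_sqrt Real.pi_pos.le]
    have hsqrt : 0 < √Real.pi := Real.sqrt_pos.mpr Real.pi_pos
    rw [hpow, hpi]
    push_cast
    field_simp
  have e1 : ((m + 3 : ℕ) : ℝ) - 1 = m + 2 := by push_cast; ring
  have e2 : ((m + 3 : ℕ) : ℝ) - 2 = m + 1 := by push_cast; ring
  have e3 : ((m + 3 : ℕ) : ℂ) - 2 = m + 1 := by push_cast; ring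
  rw [show m + 3 - 1 = m + 2 from rfl, e1, e2, e3,
    integral_radial_euclideanSpace (n := m + 2) (by omega)
      (fun r => exp (-I * (r : ℂ) * ((t : ℂ) - (s : ℂ) * I)) / (r : ℂ)), hradial]
  have hconst' := congrArg (fun x : ℝ => (x : ℂ)) hconst
  simp only [ofReal_mul, ofReal_div, ofReal_one, ofReal_pow, ofReal_ofNat] at hconst' ⊢
  linear_combination (Real.Gamma (m + 1) : ℂ) *
    (I * (t : ℂ) + (s : ℂ)) ^ (-((m : ℂ) + 1)) * hconst'
end

section
/- Let d ≥ 2 and let z = x + iy ∈ ℂ^d with y ∈ V₊ or −y ∈ V₊ (i.e. z lies in the future or past tube). Then the complex Minkowski square z·z does not belong to the half-line [0, ∞) ⊂ ℂ. Consequently, for z₁ ∈ T₋ and z₂ ∈ T₊ one has (z₁ − z₂)·(z₁ − z₂) ∈ ℂ \ [0, ∞). -/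
open Finset Complex

theorem sum_sq_lt_of_minkR_self_pos {d : ℕ} [NeZero d] {y : Fin d → ℝ} (hy : 0 < minkR d y y) :
    ∑ i ∈ Finset.univ.erase 0, y i ^ 2 < y 0 ^ 2 := by
  simp only [minkR, ← sq] at hy
  linarith

/-- Two forward timelike vectors have positive Minkowski product. -/
theorem minkR_pos_of_mem_Vplus {d : ℕ} [NeZero d] {a b : Fin d → ℝ}
    (ha : a ∈ Vplus d) (hb : b ∈ Vplus d) : 0 < minkR d a b := by
  have hcs := Finset.sum_mul_sq_le_sq_mul_sq (Finset.univ.erase 0) a b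
  have hlt : (∑ i ∈ Finset.univ.erase 0, a i * b i) ^ 2 < (a 0 * b 0) ^ 2 := by
    rw [mul_pow]
    exact hcs.trans_lt (mul_lt_mul'' (sum_sq_lt_of_minkR_self_pos ha.1)
      (sum_sq_lt_of_minkR_self_pos hb.1) (Finset.sum_nonneg fun _ _ => sq_nonneg _)
      (Finset.sum_nonneg fun _ _ => sq_nonneg _))
  exact sub_pos.2 (lt_of_pow_lt_pow_left₀ 2 (mul_pos ha.2 hb.2).le hlt)

/-- Two timelike vectors are never Minkowski-orthogonal. -/
theorem minkR_ne_zero_of_self_pos {d : ℕ} [NeZero d] {x y : Fin d → ℝ}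
    (hx : 0 < minkR d x x) (hy : 0 < minkR d y y) : minkR d x y ≠ 0 := by
  intro h
  have hcs := Finset.sum_mul_sq_le_sq_mul_sq (Finset.univ.erase 0) x y
  have hlt := mul_lt_mul'' (sum_sq_lt_of_minkR_self_pos hx) (sum_sq_lt_of_minkR_self_pos hy)
    (Finset.sum_nonneg fun _ _ => sq_nonneg _) (Finset.sum_nonneg fun _ _ => sq_nonneg _)
  rw [← sub_eq_zero.1 h, mul_pow] at hcs
  exact hcs.not_gt hlt

theorem minkR_add_self {d : ℕ} [NeZero d] (a b : Fin d → ℝ) :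
    minkR d (a + b) (a + b) = minkR d a a + 2 * minkR d a b + minkR d b b := by
  have h : ∑ i ∈ Finset.univ.erase 0, (a + b) i * (a + b) i =
      ∑ i ∈ Finset.univ.erase 0, a i * a i + 2 * ∑ i ∈ Finset.univ.erase 0, a i * b i +
        ∑ i ∈ Finset.univ.erase 0, b i * b i := by
    rw [Finset.mul_sum, ← Finset.sum_add_distrib, ← Finset.sum_add_distrib]
    exact Finset.sum_congr rfl fun i _ => by simp only [Pi.add_apply]; ring
  simp only [minkR, h]
  simp only [Pi.add_apply]
  ring

/-- The forward cone is closed under addition. -/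
theorem add_mem_Vplus {d : ℕ} [NeZero d] {a b : Fin d → ℝ}
    (ha : a ∈ Vplus d) (hb : b ∈ Vplus d) : a + b ∈ Vplus d := by
  refine ⟨?_, add_pos ha.2 hb.2⟩
  rw [minkR_add_self]
  linarith [ha.1, hb.1, minkR_pos_of_mem_Vplus ha hb]

theorem minkC_self_re {d : ℕ} [NeZero d] (z : Fin d → ℂ) :
    (minkC d z z).re =
      minkR d (fun i => (z i).re) (fun i => (z i).re) -
        minkR d (fun i => (z i).im) (fun i => (z i).im) := by
  simp only [minkC, minkR, Complex.sub_re, Complex.mul_re, Complex.re_sum,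
    Finset.sum_sub_distrib]
  ring

theorem minkC_self_im {d : ℕ} [NeZero d] (z : Fin d → ℂ) :
    (minkC d z z).im = 2 * minkR d (fun i => (z i).re) (fun i => (z i).im) := by
  have h : ∀ w : ℂ, (w * w).im = 2 * (w.re * w.im) := fun w => by
    rw [Complex.mul_im]; ring
  simp only [minkC, minkR, Complex.sub_im, Complex.im_sum, h, ← Finset.mul_sum]
  ring

/-- If the imaginary part is timelike, the complex Minkowski square avoids `[0, ∞)`. -/
theorem minkC_self_ne_ofReal_of_im_timelike {d : ℕ} [NeZero d] {z : Fin d → ℂ}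
    (hz : 0 < minkR d (fun i => (z i).im) (fun i => (z i).im)) {r : ℝ} (hr : 0 ≤ r) :
    minkC d z z ≠ (r : ℂ) := by
  intro h
  have hre := minkC_self_re z
  have him := minkC_self_im z
  rw [h, Complex.ofReal_re] at hre
  rw [h, Complex.ofReal_im] at him
  exact minkR_ne_zero_of_self_pos (by linarith) hz (by linarith)

theorem sub_mem_Tminus {d : ℕ} [NeZero d] {z₁ z₂ : Fin d → ℂ}
    (h₁ : z₁ ∈ Tminus d) (h₂ : z₂ ∈ Tplus d) : z₁ - z₂ ∈ Tminus d := by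
  have h := add_mem_Vplus h₁ h₂
  have e : (fun i => -((z₁ - z₂) i).im) = (fun i => -(z₁ i).im) + fun i => (z₂ i).im := by
    funext i
    simp only [Pi.sub_apply, Pi.add_apply, Complex.sub_im]
    ring
  rwa [← e] at h

/-- For `z` in the future or past tube, the complex Minkowski square `z·z` avoids the
half-line `[0, ∞)`; consequently `(z₁ − z₂)² ∈ ℂ \ [0, ∞)` for `z₁ ∈ T₋`, `z₂ ∈ T₊`. -/
theorem mink_square_avoids_cut (d : ℕ) [NeZero d] (hd : 2 ≤ d) :
    (∀ z ∈ Tplus d ∪ Tminus d, ∀ r : ℝ, 0 ≤ r → minkC d z z ≠ (r : ℂ)) ∧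
      (∀ z₁ ∈ Tminus d, ∀ z₂ ∈ Tplus d, ∀ r : ℝ, 0 ≤ r →
        minkC d (z₁ - z₂) (z₁ - z₂) ≠ (r : ℂ)) := by
  have key : ∀ z ∈ Tplus d ∪ Tminus d, ∀ r : ℝ, 0 ≤ r → minkC d z z ≠ (r : ℂ) := by
    rintro z (hz | hz) r hr
    · exact minkC_self_ne_ofReal_of_im_timelike hz.1 hr
    · refine minkC_self_ne_ofReal_of_im_timelike ?_ hr
      simpa only [minkR, neg_mul_neg] using hz.1
  exact ⟨key, fun z₁ h₁ z₂ h₂ => key _ (Or.inr (sub_mem_Tminus h₁ h₂))⟩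
end

section
/- Let d ≥ 2 and let W : T₋ × T₊ → ℂ be holomorphic. Assume (i) translation invariance: W(z₁ + a, z₂ + a) = W(z₁, z₂) for all a ∈ ℝ^d, and (ii) Lorentz invariance: W(Λz₁, Λz₂) = W(z₁, z₂) for every real d×d matrix Λ preserving the Minkowski bilinear form with det Λ = 1 and Λ^0_0 > 0. Then there exists a function F, holomorphic on the cut plane ℂ \ [0, ∞), such that W(z₁, z₂) = F((z₁ − z₂)·(z₁ − z₂)) for all (z₁, z₂) ∈ T₋ × T₊; i.e. W depends only on the Lorentz-invariant variable λ = (z₁ − z₂)². -/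
open Finset Complex

/-- A holomorphic function on a convex open set which is constant along a horizontal line
through a point of the set is constant. -/
lemma eq_of_constant_on_horizontal_line {S : Set ℂ} (hS : IsOpen S) (hc : Convex ℝ S)
    {h : ℂ → ℂ} (hd : DifferentiableOn ℂ h S) {z₀ : ℂ} (hz₀ : z₀ ∈ S)
    (hline : ∀ r : ℝ, h (z₀ + r) = h z₀) {z : ℂ} (hz : z ∈ S) : h z = h z₀ := by
  refine AnalyticOnNhd.eqOn_of_preconnected_of_frequently_eq (f := h) (g := fun _ => h z₀)
    (hd.analyticOnNhd hS) analyticOnNhd_const hc.isPreconnected hz₀ ?_ hz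
  have ht : Filter.Tendsto (fun r : ℝ => z₀ + (r : ℂ)) (nhdsWithin 0 {0}ᶜ)
      (nhdsWithin z₀ {z₀}ᶜ) := by
    refine tendsto_nhdsWithin_iff.2 ⟨?_, ?_⟩
    · have : Continuous (fun r : ℝ => z₀ + (r : ℂ)) := by fun_prop
      simpa using (this.tendsto 0).mono_left nhdsWithin_le_nhds
    · filter_upwards [self_mem_nhdsWithin] with r hr
      simpa using hr
  exact ht.frequently (Filter.Frequently.of_forall hline)

lemma minkR_pos_of_mem_Vplus_s5 {d : ℕ} [NeZero d] {x y : Fin d → ℝ} (hx : x ∈ Vplus d)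
    (hy : y ∈ Vplus d) : 0 < minkR d x y := by
  obtain ⟨hx1, hx0⟩ := hx
  obtain ⟨hy1, hy0⟩ := hy
  unfold minkR at *
  have cs := Finset.sum_mul_sq_le_sq_mul_sq (univ.erase (0 : Fin d)) x y
  simp only [sq] at cs
  have hA : 0 ≤ ∑ i ∈ univ.erase (0 : Fin d), x i * x i :=
    Finset.sum_nonneg fun i _ => mul_self_nonneg _
  have hB : 0 ≤ ∑ i ∈ univ.erase (0 : Fin d), y i * y i :=
    Finset.sum_nonneg fun i _ => mul_self_nonneg _
  have hxy : 0 < x 0 * y 0 := mul_pos hx0 hy0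
  have hlt : (∑ i ∈ univ.erase (0 : Fin d), x i * x i) * ∑ i ∈ univ.erase (0 : Fin d), y i * y i
      < (x 0 * x 0) * (y 0 * y 0) :=
    mul_lt_mul'' (by linarith) (by linarith) hA hB
  have := abs_lt_of_sq_lt_sq (a := ∑ i ∈ univ.erase (0 : Fin d), x i * y i) (b := x 0 * y 0)
    (by nlinarith) hxy.le
  linarith [(abs_lt.1 this).2]

lemma convex_Vplus (d : ℕ) [NeZero d] : Convex ℝ (Vplus d) := by
  intro x hx y hy a b ha hb hab
  have hxy := minkR_pos_of_mem_Vplus_s5 hx hy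
  obtain ⟨hx1, hx0⟩ := hx
  obtain ⟨hy1, hy0⟩ := hy
  have hexp : minkR d (a • x + b • y) (a • x + b • y)
      = a ^ 2 * minkR d x x + 2 * (a * b) * minkR d x y + b ^ 2 * minkR d y y := by
    simp only [minkR, Pi.add_apply, Pi.smul_apply, smul_eq_mul, mul_sub, Finset.mul_sum]
    rw [show ∀ p q r s t u : ℝ, p - q + (r - s) + (t - u) = p + r + t - (q + s + u) by
      intros; ring, ← Finset.sum_add_distrib, ← Finset.sum_add_distrib]
    congr 1
    · ring
    · exact Finset.sum_congr rfl fun i _ => by ring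
  have hab' : 0 < a ∨ 0 < b := by
    by_contra! h
    linarith
  refine ⟨?_, ?_⟩
  · rw [hexp]
    rcases hab' with h | h <;> positivity
  · simp only [Pi.add_apply, Pi.smul_apply, smul_eq_mul]
    rcases hab' with h | h <;> positivity

lemma isOpen_Vplus (d : ℕ) [NeZero d] : IsOpen (Vplus d) := by
  have h1 : Continuous fun y : Fin d → ℝ => minkR d y y := by
    unfold minkR
    fun_prop
  exact (isOpen_lt continuous_const h1).inter (isOpen_lt continuous_const (continuous_apply 0))

section Boost

variable {R : Type*} [CommRing R] {n : Type*} [Fintype n] [DecidableEq n]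

/-- A product of three shears in the plane of the indices `p` and `q`. -/
def shearProduct (p q : n) (a s : R) : Matrix n n R :=
  Matrix.transvection p q a * Matrix.transvection q p s * Matrix.transvection p q a

lemma transvection_mulVec (p q : n) (a : R) (v : n → R) :
    (Matrix.transvection p q a).mulVec v = Function.update v p (v p + a * v q) := by
  ext j
  rw [Matrix.transvection, Matrix.add_mulVec, Matrix.one_mulVec, Matrix.single_mulVec]
  by_cases h : j = p
  · subst h; simp
  · simp [h]

lemma shearProduct_mulVec {p q : n} (hpq : p ≠ q) {a s c : R} (h1 : 1 + a * s = c)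
    (h2 : a * (1 + c) = s) (v : n → R) :
    (shearProduct p q a s).mulVec v =
      Function.update (Function.update v p (c * v p + s * v q)) q (s * v p + c * v q) := by
  rw [shearProduct, ← Matrix.mulVec_mulVec, ← Matrix.mulVec_mulVec]
  simp only [transvection_mulVec]
  ext j
  by_cases hp : j = p
  · subst hp
    simp [hpq, hpq.symm]
    linear_combination v j * h1 + v q * h2 + a * v q * h1
  · by_cases hq : j = q
    · subst hq
      simp [hpq, hp]
      linear_combination v j * h1
    · simp [hp, hq]

lemma det_shearProduct {p q : n} (hpq : p ≠ q) (a s : R) : (shearProduct p q a s).det = 1 := by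
  simp [shearProduct, Matrix.det_transvection_of_ne, hpq, hpq.symm]

lemma map_shearProduct {S : Type*} [CommRing S] (φ : R →+* S) (p q : n) (a s : R) :
    (shearProduct p q a s).map φ = shearProduct p q (φ a) (φ s) := by
  simp [shearProduct, Matrix.map_mul, Matrix.transvection, Matrix.map_add]

end Boost

lemma minkR_eq_sub_sum {d : ℕ} [NeZero d] {i : Fin d} (hi : i ≠ 0) (x y : Fin d → ℝ) :
    minkR d x y = x 0 * y 0 - x i * y i - ∑ j ∈ (univ.erase 0).erase i, x j * y j := by
  rw [minkR, ← Finset.add_sum_erase (univ.erase 0) (fun j => x j * y j)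
    (Finset.mem_erase.2 ⟨hi, Finset.mem_univ i⟩)]
  ring

lemma minkC_eq_sub_sum {d : ℕ} [NeZero d] {i : Fin d} (hi : i ≠ 0) (x y : Fin d → ℂ) :
    minkC d x y = x 0 * y 0 - x i * y i - ∑ j ∈ (univ.erase 0).erase i, x j * y j := by
  rw [minkC, ← Finset.add_sum_erase (univ.erase 0) (fun j => x j * y j)
    (Finset.mem_erase.2 ⟨hi, Finset.mem_univ i⟩)]
  ring

/-- Replace the components of `z` in the `(0, i)` plane by `(u, v)`. -/
def setPlane {d : ℕ} [NeZero d] {R : Type*} (z : Fin d → R) (i : Fin d) (u v : R) : Fin d → R :=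
  Function.update (Function.update z 0 u) i v

section setPlane

variable {d : ℕ} [NeZero d] {R : Type*} {i : Fin d}

lemma setPlane_zero (hi : i ≠ 0) (z : Fin d → R) (u v : R) : setPlane z i u v 0 = u := by
  simp [setPlane, hi.symm]

lemma setPlane_self (z : Fin d → R) (u v : R) : setPlane z i u v i = v := by
  simp [setPlane]

lemma setPlane_of_ne {j : Fin d} (hj0 : j ≠ 0) (hji : j ≠ i) (z : Fin d → R) (u v : R) :
    setPlane z i u v j = z j := by
  simp [setPlane, hj0, hji]

lemma sum_setPlane {S : Type*} [AddCommMonoid S] (φ : R → R → S) (z z' : Fin d → R)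
    (u v u' v' : R) :
    ∑ j ∈ (univ.erase 0).erase i, φ (setPlane z i u v j) (setPlane z' i u' v' j)
      = ∑ j ∈ (univ.erase 0).erase i, φ (z j) (z' j) := by
  refine Finset.sum_congr rfl fun j hj => ?_
  simp only [Finset.mem_erase, Finset.mem_univ, and_true] at hj
  rw [setPlane_of_ne hj.2 hj.1, setPlane_of_ne hj.2 hj.1]

lemma setPlane_mem_Tplus (hi : i ≠ 0) {z : Fin d → ℂ} {u v : ℂ} :
    setPlane z i u v ∈ Tplus d ↔
      ∑ j ∈ (univ.erase 0).erase i, (z j).im * (z j).im < u.im ^ 2 - v.im ^ 2 ∧ 0 < u.im := by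
  have := sum_setPlane (i := i) (fun a b : ℂ => a.im * b.im) z z u v u v
  simp only [Tplus, Vplus, Set.mem_ofPred_eq, minkR_eq_sub_sum hi, setPlane_zero hi, setPlane_self,
    this, sq, sub_pos]

lemma minkC_setPlane (hi : i ≠ 0) (z : Fin d → ℂ) (u v : ℂ) :
    minkC d (setPlane z i u v) (setPlane z i u v) =
      u ^ 2 - v ^ 2 - ∑ j ∈ (univ.erase 0).erase i, z j * z j := by
  rw [minkC_eq_sub_sum hi, setPlane_zero hi, setPlane_self,
    sum_setPlane (fun a b : ℂ => a * b), sq, sq]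

lemma setPlane_eta (z : Fin d → R) : setPlane z i (z 0) (z i) = z := by
  simp [setPlane]

end setPlane

/-- The boost of rapidity `r` in the `(0, i)` plane. -/
noncomputable def boost {d : ℕ} [NeZero d] (i : Fin d) (r : ℝ) : Matrix (Fin d) (Fin d) ℝ :=
  shearProduct 0 i (Real.sinh r / (1 + Real.cosh r)) (Real.sinh r)

lemma boost_relations (r : ℝ) :
    1 + Real.sinh r / (1 + Real.cosh r) * Real.sinh r = Real.cosh r ∧
      Real.sinh r / (1 + Real.cosh r) * (1 + Real.cosh r) = Real.sinh r := by
  have : 1 + Real.cosh r ≠ 0 := by positivity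
  refine ⟨?_, by field_simp⟩
  field_simp
  linear_combination -Real.cosh_sq r

section boost

variable {d : ℕ} [NeZero d] {i : Fin d}

lemma boost_mulVec (hi : i ≠ 0) (r : ℝ) (x : Fin d → ℝ) :
    (boost i r).mulVec x = setPlane x i (Real.cosh r * x 0 + Real.sinh r * x i)
      (Real.sinh r * x 0 + Real.cosh r * x i) :=
  shearProduct_mulVec hi.symm (boost_relations r).1 (boost_relations r).2 x

lemma boost_map_mulVec (hi : i ≠ 0) (r : ℝ) (z : Fin d → ℂ) :
    ((boost i r).map Complex.ofReal).mulVec z = setPlane z i (cosh r * z 0 + sinh r * z i)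
      (sinh r * z 0 + cosh r * z i) := by
  have := map_shearProduct Complex.ofRealHom (0 : Fin d) i (Real.sinh r / (1 + Real.cosh r))
    (Real.sinh r)
  rw [← Complex.ofReal_cosh, ← Complex.ofReal_sinh]
  refine (congrArg (fun M => Matrix.mulVec M z) this).trans (shearProduct_mulVec hi.symm ?_ ?_ z)
  · simp only [Complex.ofRealHom_eq_coe]
    exact_mod_cast (boost_relations r).1
  · simp only [Complex.ofRealHom_eq_coe]
    exact_mod_cast (boost_relations r).2

lemma minkR_boost (hi : i ≠ 0) (r : ℝ) (x y : Fin d → ℝ) :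
    minkR d ((boost i r).mulVec x) ((boost i r).mulVec y) = minkR d x y := by
  rw [boost_mulVec hi, boost_mulVec hi, minkR_eq_sub_sum hi, minkR_eq_sub_sum hi x y,
    setPlane_zero hi, setPlane_zero hi, setPlane_self, setPlane_self,
    sum_setPlane (fun a b : ℝ => a * b)]
  linear_combination (x 0 * y 0 - x i * y i) * Real.cosh_sq r

lemma det_boost (hi : i ≠ 0) (r : ℝ) : (boost i r).det = 1 :=
  det_shearProduct hi.symm _ _

lemma boost_zero_zero (hi : i ≠ 0) (r : ℝ) : 0 < boost i r 0 0 := by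
  have h := congrFun (boost_mulVec hi r (Pi.single 0 1)) 0
  rw [setPlane_zero hi] at h
  simp [hi] at h
  rw [h]
  positivity

end boost

lemma arg_mem_Ioo_of_im_pos {z : ℂ} (hz : 0 < z.im) : z.arg ∈ Set.Ioo 0 Real.pi := by
  refine ⟨lt_of_le_of_ne (Complex.arg_nonneg_iff.2 hz.le) fun h => ?_,
    Complex.arg_lt_pi_iff.2 (Or.inr hz.ne')⟩
  exact hz.ne' (Complex.arg_eq_zero_iff.1 h.symm).2

/-- Hyperbolic polar coordinates on the two-dimensional future tube. -/
lemma exists_eq_mul_cosh_sinh {u v : ℂ} (h₁ : 0 < (u + v).im) (h₂ : 0 < (u - v).im) :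
    ∃ w τ : ℂ, u = w * cosh τ ∧ v = w * sinh τ ∧ 0 < w.im ∧ |τ.im| < Real.pi / 2 := by
  obtain ⟨hp0, hpπ⟩ := arg_mem_Ioo_of_im_pos h₁
  obtain ⟨hq0, hqπ⟩ := arg_mem_Ioo_of_im_pos h₂
  have hp : u + v ≠ 0 := fun h => by simp [h] at h₁
  have hq : u - v ≠ 0 := fun h => by simp [h] at h₂
  have e₁ : exp ((log (u + v) + log (u - v)) / 2) * exp ((log (u + v) - log (u - v)) / 2)
      = u + v := by
    rw [← Complex.exp_add, ← add_div, add_add_sub_cancel, add_self_div_two, exp_log hp]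
  have e₂ : exp ((log (u + v) + log (u - v)) / 2) * exp (-((log (u + v) - log (u - v)) / 2))
      = u - v := by
    rw [← Complex.exp_add, ← sub_eq_add_neg, ← sub_div, add_sub_sub_cancel, add_self_div_two,
      exp_log hq]
  refine ⟨exp ((log (u + v) + log (u - v)) / 2), (log (u + v) - log (u - v)) / 2, ?_, ?_, ?_, ?_⟩
  · rw [Complex.cosh]
    linear_combination -(e₁ + e₂) / 2
  · rw [Complex.sinh]
    linear_combination -(e₁ - e₂) / 2
  · rw [exp_im]
    refine mul_pos (Real.exp_pos _) (Real.sin_pos_of_pos_of_lt_pi ?_ ?_) <;>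
    · simp only [div_ofNat_im, add_im, log_im]
      simp only [add_im, sub_im] at *
      linarith
  · simp only [div_ofNat_im, sub_im, log_im]
    simp only [sub_im] at *
    rw [abs_lt]
    constructor <;> linarith

lemma im_mul_cosh (w τ : ℂ) : (w * cosh τ).im =
    w.re * (Real.sinh τ.re * Real.sin τ.im) + w.im * (Real.cosh τ.re * Real.cos τ.im) := by
  conv_lhs => rw [← re_add_im τ, Complex.cosh_add, cosh_mul_I, sinh_mul_I,
    ← ofReal_cosh, ← ofReal_sinh, ← ofReal_cos, ← ofReal_sin]
  simp [mul_im, -ofReal_cosh, -ofReal_sinh, -ofReal_cos, -ofReal_sin]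

lemma im_mul_sinh (w τ : ℂ) : (w * sinh τ).im =
    w.re * (Real.cosh τ.re * Real.sin τ.im) + w.im * (Real.sinh τ.re * Real.cos τ.im) := by
  conv_lhs => rw [← re_add_im τ, Complex.sinh_add, cosh_mul_I, sinh_mul_I,
    ← ofReal_cosh, ← ofReal_sinh, ← ofReal_cos, ← ofReal_sin]
  simp [mul_im, -ofReal_cosh, -ofReal_sinh, -ofReal_cos, -ofReal_sin]

lemma im_mul_cosh_sq_sub_im_mul_sinh_sq (w τ : ℂ) :
    (w * cosh τ).im ^ 2 - (w * sinh τ).im ^ 2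
      = w.im ^ 2 - normSq w * Real.sin τ.im ^ 2 := by
  rw [im_mul_cosh, im_mul_sinh, normSq_apply]
  have h1 := Real.cosh_sq τ.re
  have h2 := Real.sin_sq_add_cos_sq τ.im
  linear_combination (w.im ^ 2 * Real.cos τ.im ^ 2 - w.re ^ 2 * Real.sin τ.im ^ 2) * h1
    + w.im ^ 2 * h2

lemma im_mul_cosh_pos {w τ : ℂ} (hw : 0 < w.im) (hτ : |τ.im| < Real.pi / 2)
    (h : 0 < (w * cosh τ).im ^ 2 - (w * sinh τ).im ^ 2) : 0 < (w * cosh τ).im := by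
  have hcos : 0 < Real.cos τ.im := Real.cos_pos_of_mem_Ioo (abs_lt.1 hτ)
  have hc := Real.cosh_pos τ.re
  have hsq := Real.cosh_sq τ.re
  have hcomb : Real.cosh τ.re * (w * cosh τ).im - Real.sinh τ.re * (w * sinh τ).im
      = w.im * Real.cos τ.im := by
    rw [im_mul_cosh, im_mul_sinh]
    linear_combination w.im * Real.cos τ.im * hsq
  have hpos := mul_pos hw hcos
  rw [← hcomb] at hpos
  generalize (w * cosh τ).im = A at *
  generalize (w * sinh τ).im = B at *
  by_contra! hA
  have h1 : |B| ≤ -A := abs_le_of_sq_le_sq (by linarith [neg_sq A]) (by linarith)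
  have h2 : |Real.sinh τ.re| ≤ Real.cosh τ.re := abs_le_of_sq_le_sq (by linarith) hc.le
  have h3 : |Real.sinh τ.re| * |B| ≤ Real.cosh τ.re * -A :=
    mul_le_mul h2 h1 (abs_nonneg _) hc.le
  rw [← abs_mul] at h3
  linarith [neg_abs_le (Real.sinh τ.re * B)]

section elimination

variable {d : ℕ} [NeZero d]

/-- A spatial component of a point of the future tube can be removed by a complex boost without
leaving the future tube and without changing a boost-invariant holomorphic function. -/
lemma exists_setPlane_mem_Tplus {f : (Fin d → ℂ) → ℂ} (hf : DifferentiableOn ℂ f (Tplus d))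
    {i : Fin d} (hi : i ≠ 0)
    (hinv : ∀ r : ℝ, ∀ z ∈ Tplus d, f (((boost i r).map Complex.ofReal).mulVec z) = f z)
    {z : Fin d → ℂ} (hz : z ∈ Tplus d) :
    ∃ w : ℂ, setPlane z i w 0 ∈ Tplus d ∧ f (setPlane z i w 0) = f z ∧
      minkC d (setPlane z i w 0) (setPlane z i w 0) = minkC d z z := by
  have hz' := hz
  rw [← setPlane_eta (i := i) z, setPlane_mem_Tplus hi] at hz'
  obtain ⟨hsum, h0⟩ := hz'
  have hC : 0 ≤ ∑ j ∈ (univ.erase 0).erase i, (z j).im * (z j).im :=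
    Finset.sum_nonneg fun j _ => mul_self_nonneg _
  have habs : |(z i).im| < (z 0).im := abs_lt_of_sq_lt_sq (by linarith) h0.le
  obtain ⟨w, τ₀, hu, hv, hw, hτ₀⟩ := exists_eq_mul_cosh_sinh (u := z 0) (v := z i)
    (by simp only [add_im]; linarith [(abs_lt.1 habs).1])
    (by simp only [sub_im]; linarith [(abs_lt.1 habs).2])
  set C := ∑ j ∈ (univ.erase 0).erase i, (z j).im * (z j).im with hCdef
  have hN : 0 < normSq w := normSq_pos.2 fun h => by simp [h] at hw
  rw [hu, hv, im_mul_cosh_sq_sub_im_mul_sinh_sq] at hsum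
  have hk : Real.sin τ₀.im ^ 2 < (w.im ^ 2 - C) / normSq w := by
    rw [lt_div_iff₀ hN]
    linarith
  set k := √((w.im ^ 2 - C) / normSq w) with hkdef
  have hk0 : 0 < k := Real.sqrt_pos.2 (lt_of_le_of_lt (sq_nonneg _) hk)
  have hksq : normSq w * k ^ 2 = w.im ^ 2 - C := by
    rw [hkdef, Real.sq_sqrt (lt_of_le_of_lt (sq_nonneg _) hk).le]
    field_simp
  have hk1 : k ≤ 1 := by
    rw [hkdef, Real.sqrt_le_left zero_le_one, one_pow, div_le_one hN, normSq_apply]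
    nlinarith [mul_self_nonneg w.re]
  set S : Set ℂ := {τ | τ.im ∈ Set.Ioo (-Real.arcsin k) (Real.arcsin k)} with hS
  have hSabs : ∀ τ : ℂ, τ ∈ S ↔ |τ.im| < Real.arcsin k := fun τ => by
    simp [hS, abs_lt]
  have hSo : IsOpen S := isOpen_Ioo.preimage continuous_im
  have hSc : Convex ℝ S := (convex_Ioo _ _).linear_preimage Complex.imLm
  have hmem : ∀ τ ∈ S, setPlane z i (w * cosh τ) (w * sinh τ) ∈ Tplus d := by
    intro τ hτ
    rw [hSabs] at hτ
    have hτ' : |τ.im| < Real.pi / 2 := hτ.trans_le (Real.arcsin_le_pi_div_two k)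
    have hsin : Real.sin |τ.im| < k :=
      (Real.lt_arcsin_iff_sin_lt' ⟨by linarith [abs_nonneg τ.im, Real.pi_pos], hτ'⟩).1 hτ
    have hsin0 : 0 ≤ Real.sin |τ.im| :=
      Real.sin_nonneg_of_nonneg_of_le_pi (abs_nonneg _) (by linarith [Real.pi_pos])
    have hsq : Real.sin τ.im ^ 2 < k ^ 2 := by
      have : Real.sin |τ.im| ^ 2 = Real.sin τ.im ^ 2 := by
        rcases abs_cases τ.im with h | h <;> simp [h.1]
      rw [← this]
      gcongr
    have hlt : C < (w * cosh τ).im ^ 2 - (w * sinh τ).im ^ 2 := by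
      rw [im_mul_cosh_sq_sub_im_mul_sinh_sq]
      nlinarith [mul_lt_mul_of_pos_left hsq hN]
    rw [setPlane_mem_Tplus hi]
    exact ⟨hlt, im_mul_cosh_pos hw hτ' (by linarith)⟩
  have hτ₀S : τ₀ ∈ S := by
    have : |Real.sin τ₀.im| < k := Real.lt_sqrt_of_sq_lt (by rwa [sq_abs])
    have hb := abs_lt.1 hτ₀
    refine ⟨?_, ?_⟩
    · rw [← Real.arcsin_neg, Real.arcsin_lt_iff_lt_sin' ⟨hb.1, hb.2.le⟩]
      exact (abs_lt.1 this).1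
    · rw [Real.lt_arcsin_iff_sin_lt' ⟨hb.1.le, hb.2⟩]
      exact (abs_lt.1 this).2
  have h0S : (0 : ℂ) ∈ S := by
    rw [hSabs]
    simpa using hk0
  have hdiff : DifferentiableOn ℂ (fun τ => f (setPlane z i (w * cosh τ) (w * sinh τ))) S := by
    refine hf.comp (t := Tplus d) (Differentiable.differentiableOn ?_) hmem
    rw [differentiable_pi]
    intro j
    by_cases hji : j = i
    · subst hji
      simp only [setPlane_self]
      fun_prop
    by_cases hj0 : j = 0
    · subst hj0
      simp only [setPlane_zero hi]
      fun_prop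
    · simp only [setPlane_of_ne hj0 hji]
      fun_prop
  have heta : setPlane z i (w * cosh τ₀) (w * sinh τ₀) = z := by
    rw [← hu, ← hv, setPlane_eta]
  have hconst := eq_of_constant_on_horizontal_line hSo hSc hdiff hτ₀S (fun r => by
    simp only [heta]
    rw [← hinv r z hz, boost_map_mulVec hi, hu, hv, Complex.cosh_add, Complex.sinh_add]
    congr 2 <;> ring) h0S
  have hm := hmem 0 h0S
  simp only [heta, Complex.cosh_zero, Complex.sinh_zero, mul_one, mul_zero] at hconst hm
  refine ⟨w, hm, hconst, ?_⟩
  conv_rhs => rw [← setPlane_eta (i := i) z]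
  rw [minkC_setPlane hi, minkC_setPlane hi, hu, hv]
  linear_combination -w ^ 2 * Complex.cosh_sq τ₀

lemma exists_single_mem_Tplus {f : (Fin d → ℂ) → ℂ} (hf : DifferentiableOn ℂ f (Tplus d))
    (hinv : ∀ i : Fin d, i ≠ 0 → ∀ r : ℝ, ∀ z ∈ Tplus d,
      f (((boost i r).map Complex.ofReal).mulVec z) = f z)
    {z : Fin d → ℂ} (hz : z ∈ Tplus d) :
    ∃ w : ℂ, 0 < w.im ∧ f (Pi.single 0 w) = f z ∧ w ^ 2 = minkC d z z := by
  have key : ∀ s : Finset (Fin d), 0 ∉ s → ∃ z' ∈ Tplus d, f z' = f z ∧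
      minkC d z' z' = minkC d z z ∧ ∀ i ∈ s, z' i = 0 := by
    intro s
    induction s using Finset.induction_on with
    | empty => exact fun _ => ⟨z, hz, rfl, rfl, by simp⟩
    | insert i s his ih =>
      intro h0
      rw [Finset.mem_insert, not_or] at h0
      have hi : i ≠ 0 := Ne.symm h0.1
      obtain ⟨z', hz', hfz', hm, hs⟩ := ih h0.2
      obtain ⟨w, hw, hfw, hmw⟩ := exists_setPlane_mem_Tplus hf hi (hinv i hi) hz'
      refine ⟨_, hw, hfw.trans hfz', hmw.trans hm, fun j hj => ?_⟩
      by_cases hji : j = i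
      · rw [hji, setPlane_self]
      · have hjs := (Finset.mem_insert.1 hj).resolve_left hji
        rw [setPlane_of_ne (fun h => h0.2 (h ▸ hjs)) hji, hs j hjs]
  obtain ⟨z', hz', hfz', hm, hs⟩ := key (univ.erase 0) (by simp)
  have hz'0 : z' = Pi.single 0 (z' 0) := by
    ext j
    by_cases hj : j = 0
    · subst hj; simp
    · rw [hs j (by simp [hj])]
      simp [hj]
  refine ⟨z' 0, hz'.2, hz'0 ▸ hfz', ?_⟩
  rw [← hm, minkC, Finset.sum_eq_zero fun i hi => by rw [hs i hi, mul_zero]]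
  ring

lemma single_mem_Tplus {w : ℂ} (hw : 0 < w.im) : (Pi.single 0 w : Fin d → ℂ) ∈ Tplus d := by
  refine ⟨?_, by simpa using hw⟩
  rw [minkR, Finset.sum_eq_zero fun i hi => by simp [Finset.ne_of_mem_erase hi]]
  simpa using hw.ne'

end elimination

/-- The square root with values in the closed upper half-plane. -/
noncomputable def upperSqrt (z : ℂ) : ℂ := I * (-z) ^ (2⁻¹ : ℂ)

lemma upperSqrt_sq {w : ℂ} (hw : 0 < w.im) : upperSqrt (w ^ 2) = w := by
  have h := sq_cpow_two_inv (x := -I * w) (by simpa using hw)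
  have h' : -(w ^ 2) = (-I * w) ^ 2 := by
    rw [mul_pow, neg_sq, I_sq]
    ring
  rw [upperSqrt, h', h]
  linear_combination -w * I_sq

lemma neg_mem_slitPlane {z : ℂ} (hz : ∀ r : ℝ, 0 ≤ r → z ≠ r) : -z ∈ slitPlane := by
  by_contra h
  simp only [mem_slitPlane_iff, neg_re, neg_im, not_or, not_lt, Left.neg_pos_iff, ne_eq,
    neg_eq_zero, not_not] at h
  exact hz z.re h.1 (Complex.ext (by simp) (by simp [h.2]))

lemma upperSqrt_im_pos {z : ℂ} (hz : ∀ r : ℝ, 0 ≤ r → z ≠ r) : 0 < (upperSqrt z).im := by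
  have hs := neg_mem_slitPlane hz
  have h0 : -z ≠ 0 := slitPlane_ne_zero hs
  have hre : 0 < ((-z) ^ (2⁻¹ : ℂ)).re := by
    rw [cpow_def_of_ne_zero h0, exp_re]
    have him : (log (-z) * 2⁻¹).im = (-z).arg / 2 := by
      rw [← div_eq_mul_inv, div_ofNat_im, log_im]
    rw [him]
    have h1 := neg_pi_lt_arg (-z)
    have h2 := lt_of_le_of_ne (arg_le_pi (-z)) (mem_slitPlane_iff_arg.1 hs).1
    exact mul_pos (Real.exp_pos _) (Real.cos_pos_of_mem_Ioo ⟨by linarith, by linarith⟩)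
  simpa [upperSqrt] using hre

lemma differentiableOn_upperSqrt :
    DifferentiableOn ℂ upperSqrt {w : ℂ | ∀ r : ℝ, 0 ≤ r → w ≠ (r : ℂ)} := fun _ hz =>
  ((differentiableAt_id.neg.cpow_const (neg_mem_slitPlane hz)).const_mul
    I).differentiableWithinAt

/-- A function on `T₋ × T₊` which is holomorphic and invariant under real translations depends
only on the difference of its arguments. -/
lemma eq_of_translation_invariant {d : ℕ} [NeZero d] {W : (Fin d → ℂ) → (Fin d → ℂ) → ℂ}
    (hW : DifferentiableOn ℂ (fun zz : (Fin d → ℂ) × (Fin d → ℂ) => W zz.1 zz.2)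
      (Tminus d ×ˢ Tplus d))
    (htrans : ∀ a : Fin d → ℝ, ∀ z₁ ∈ Tminus d, ∀ z₂ ∈ Tplus d,
      W (z₁ + fun i => (a i : ℂ)) (z₂ + fun i => (a i : ℂ)) = W z₁ z₂)
    {z₁ z₂ : Fin d → ℂ} (h₁ : z₁ ∈ Tminus d) (h₂ : z₂ ∈ Tplus d) (b : Fin d → ℂ)
    (h₁' : z₁ + b ∈ Tminus d) (h₂' : z₂ + b ∈ Tplus d) :
    W (z₁ + b) (z₂ + b) = W z₁ z₂ := by
  set g : ℂ → (Fin d → ℂ) := fun s i => (b i).re + s * (b i).im with hg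
  have hgcont : Continuous g := by fun_prop
  have hgim : ∀ s i, (g s i).im = s.im * (b i).im := fun s i => by simp [hg]
  set S : Set ℂ := {s | z₁ + g s ∈ Tminus d ∧ z₂ + g s ∈ Tplus d} with hS
  have hSo : IsOpen S := by
    refine IsOpen.inter (s := {s | z₁ + g s ∈ Tminus d}) (t := {s | z₂ + g s ∈ Tplus d}) ?_ ?_
    · exact (isOpen_Vplus d).preimage (f := fun s i => -((z₁ + g s) i).im) (by fun_prop)
    · exact (isOpen_Vplus d).preimage (f := fun s i => ((z₂ + g s) i).im) (by fun_prop)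
  have hSc : Convex ℝ S := by
    intro s hs t ht p q hp hq hpq
    refine ⟨?_, ?_⟩
    · change (fun i => -((z₁ + g (p • s + q • t)) i).im) ∈ Vplus d
      convert convex_Vplus d hs.1 ht.1 hp hq hpq using 1
      ext i
      simp only [Pi.add_apply, Pi.smul_apply, smul_eq_mul, add_im, hgim, real_smul,
        im_ofReal_mul]
      linear_combination (z₁ i).im * hpq
    · change (fun i => ((z₂ + g (p • s + q • t)) i).im) ∈ Vplus d
      convert convex_Vplus d hs.2 ht.2 hp hq hpq using 1
      ext i
      simp only [Pi.add_apply, Pi.smul_apply, smul_eq_mul, add_im, hgim, real_smul,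
        im_ofReal_mul]
      linear_combination -(z₂ i).im * hpq
  have hgreal : ∀ r : ℝ, g r = fun i => (((b i).re + r * (b i).im : ℝ) : ℂ) := fun r => by
    ext i
    simp [hg]
  have hgI : g I = b := by
    ext i
    rw [hg]
    simp only [mul_comm I, re_add_im]
  have hline : ∀ r : ℝ, W (z₁ + g r) (z₂ + g r) = W z₁ z₂ := fun r => by
    rw [hgreal]
    exact htrans _ z₁ h₁ z₂ h₂
  have h0S : (0 : ℂ) ∈ S := by
    refine ⟨?_, ?_⟩
    · simpa only [Tminus, Set.mem_ofPred_eq, Pi.add_apply, add_im, hgim, zero_im, zero_mul,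
        add_zero] using h₁
    · simpa only [Tplus, Set.mem_ofPred_eq, Pi.add_apply, add_im, hgim, zero_im, zero_mul,
        add_zero] using h₂
  have hIS : I ∈ S := by
    rw [hS, Set.mem_ofPred_eq, hgI]
    exact ⟨h₁', h₂'⟩
  have hgd : Differentiable ℂ g := by
    rw [differentiable_pi]
    intro i
    simp only [hg]
    fun_prop
  have hdiff : DifferentiableOn ℂ (fun s => W (z₁ + g s) (z₂ + g s)) S :=
    hW.comp (t := Tminus d ×ˢ Tplus d) (f := fun s => (z₁ + g s, z₂ + g s))
      ((hgd.const_add z₁).prodMk (hgd.const_add z₂)).differentiableOn fun s hs => hs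
  have h := eq_of_constant_on_horizontal_line hSo hSc hdiff h0S (fun r => by
    rw [zero_add, hline, ← ofReal_zero, hline]) hIS
  rw [hgI] at h
  rw [h, ← ofReal_zero, hline]

lemma pos_smul_mem_Vplus {d : ℕ} [NeZero d] {y : Fin d → ℝ} (hy : y ∈ Vplus d) {c : ℝ}
    (hc : 0 < c) : c • y ∈ Vplus d := by
  have h : minkR d (c • y) (c • y) = c ^ 2 * minkR d y y := by
    simp only [minkR, Pi.smul_apply, smul_eq_mul, mul_sub, Finset.mul_sum]
    congr 1
    · ring
    · exact Finset.sum_congr rfl fun i _ => by ring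
  refine ⟨?_, mul_pos hc hy.2⟩
  rw [h]
  exact mul_pos (pow_pos hc 2) hy.1

lemma half_smul_mem_Tplus {d : ℕ} [NeZero d] {z : Fin d → ℂ} (hz : z ∈ Tplus d) :
    (2⁻¹ : ℂ) • z ∈ Tplus d := by
  have := pos_smul_mem_Vplus hz (c := 2⁻¹) (by norm_num)
  change (fun i => (((2⁻¹ : ℂ) • z) i).im) ∈ Vplus d
  convert this using 1
  ext i
  simp [inv_mul_eq_div]

lemma neg_mem_Tminus {d : ℕ} [NeZero d] {z : Fin d → ℂ} (hz : z ∈ Tplus d) :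
    -z ∈ Tminus d := by
  simpa [Tminus, Tplus] using hz

lemma sub_mem_Tplus {d : ℕ} [NeZero d] {z₁ z₂ : Fin d → ℂ} (h₁ : z₁ ∈ Tminus d)
    (h₂ : z₂ ∈ Tplus d) : z₂ - z₁ ∈ Tplus d := by
  have := pos_smul_mem_Vplus (convex_Vplus d h₁ h₂ (a := 2⁻¹) (b := 2⁻¹) (by norm_num)
    (by norm_num) (by norm_num)) (c := 2) (by norm_num)
  change (fun i => ((z₂ - z₁) i).im) ∈ Vplus d
  convert this using 1
  ext i
  simp
  ring

lemma minkC_sub_comm {d : ℕ} [NeZero d] (x y : Fin d → ℂ) :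
    minkC d (x - y) (x - y) = minkC d (y - x) (y - x) := by
  simp only [minkC, Pi.sub_apply]
  congr 1
  · ring
  · exact Finset.sum_congr rfl fun i _ => by ring

/-- A holomorphic function on `T₋ × T₊` which is invariant under translations and under the
real restricted Lorentz group depends only on the invariant `λ = (z₁ − z₂)²`, through a
function holomorphic on the cut plane `ℂ \ [0, ∞)`. -/
theorem invariant_two_point_function_of_invariant_variable
    (d : ℕ) [NeZero d] (hd : 2 ≤ d)
    (W : (Fin d → ℂ) → (Fin d → ℂ) → ℂ)
    (hW : DifferentiableOn ℂ (fun zz : (Fin d → ℂ) × (Fin d → ℂ) => W zz.1 zz.2)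
      (Tminus d ×ˢ Tplus d))
    (htrans : ∀ a : Fin d → ℝ, ∀ z₁ ∈ Tminus d, ∀ z₂ ∈ Tplus d,
      W (z₁ + fun i => (a i : ℂ)) (z₂ + fun i => (a i : ℂ)) = W z₁ z₂)
    (hlor : ∀ Λ : Matrix (Fin d) (Fin d) ℝ,
      (∀ x y : Fin d → ℝ, minkR d (Λ.mulVec x) (Λ.mulVec y) = minkR d x y) →
      Λ.det = 1 → 0 < Λ 0 0 →
      ∀ z₁ ∈ Tminus d, ∀ z₂ ∈ Tplus d,
        W ((Λ.map Complex.ofReal).mulVec z₁) ((Λ.map Complex.ofReal).mulVec z₂)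
          = W z₁ z₂) :
    ∃ F : ℂ → ℂ,
      DifferentiableOn ℂ F {w : ℂ | ∀ r : ℝ, 0 ≤ r → w ≠ (r : ℂ)} ∧
      ∀ z₁ ∈ Tminus d, ∀ z₂ ∈ Tplus d,
        W z₁ z₂ = F (minkC d (z₁ - z₂) (z₁ - z₂)) := by
  set f : (Fin d → ℂ) → ℂ := fun z => W (-((2⁻¹ : ℂ) • z)) ((2⁻¹ : ℂ) • z) with hfdef
  have hf : DifferentiableOn ℂ f (Tplus d) := by
    have hh : Differentiable ℂ fun z : Fin d → ℂ => (2⁻¹ : ℂ) • z := by fun_prop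
    exact hW.comp (t := Tminus d ×ˢ Tplus d)
      (f := fun z => (-((2⁻¹ : ℂ) • z), (2⁻¹ : ℂ) • z))
      (hh.neg.prodMk hh).differentiableOn
      fun z hz => ⟨neg_mem_Tminus (half_smul_mem_Tplus hz), half_smul_mem_Tplus hz⟩
  have hinv : ∀ i : Fin d, i ≠ 0 → ∀ r : ℝ, ∀ z ∈ Tplus d,
      f (((boost i r).map Complex.ofReal).mulVec z) = f z := by
    intro i hi r z hz
    have hz' := half_smul_mem_Tplus hz
    rw [hfdef]
    simp only
    rw [← Matrix.mulVec_smul, ← Matrix.mulVec_neg]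
    exact hlor _ (minkR_boost hi r) (det_boost hi r) (boost_zero_zero hi r) _
      (neg_mem_Tminus hz') _ hz'
  have hWf : ∀ z₁ ∈ Tminus d, ∀ z₂ ∈ Tplus d, W z₁ z₂ = f (z₂ - z₁) := by
    intro z₁ h₁ z₂ h₂
    have hz := half_smul_mem_Tplus (sub_mem_Tplus h₁ h₂)
    have e₁ : z₁ + -((2⁻¹ : ℂ) • (z₁ + z₂)) = -((2⁻¹ : ℂ) • (z₂ - z₁)) := by module
    have e₂ : z₂ + -((2⁻¹ : ℂ) • (z₁ + z₂)) = (2⁻¹ : ℂ) • (z₂ - z₁) := by module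
    have h := eq_of_translation_invariant hW htrans h₁ h₂ (-((2⁻¹ : ℂ) • (z₁ + z₂)))
      (e₁ ▸ neg_mem_Tminus hz) (e₂ ▸ hz)
    rw [e₁, e₂] at h
    exact h.symm
  refine ⟨fun w => f (Pi.single 0 (upperSqrt w)), ?_, fun z₁ h₁ z₂ h₂ => ?_⟩
  · suffices hsingle : DifferentiableOn ℂ (fun w => (Pi.single 0 (upperSqrt w) : Fin d → ℂ))
        {w : ℂ | ∀ r : ℝ, 0 ≤ r → w ≠ (r : ℂ)} from
      hf.comp hsingle fun w hw => single_mem_Tplus (upperSqrt_im_pos hw)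
    refine differentiableOn_pi.2 fun j => ?_
    by_cases hj : j = 0
    · subst hj
      simpa only [Pi.single_eq_same] using differentiableOn_upperSqrt
    · simpa only [Pi.single_eq_of_ne hj] using differentiableOn_const (0 : ℂ)
  · obtain ⟨w, hw, hfw, hw2⟩ := exists_single_mem_Tplus hf hinv (sub_mem_Tplus h₁ h₂)
    simp only
    rw [hWf z₁ h₁ z₂ h₂, minkC_sub_comm, ← hw2, upperSqrt_sq hw, hfw]
end

section
/- Let d ≥ 2. If z₁ belongs to the chiral tube 𝒵₋ and z₂ belongs to the chiral tube 𝒵₊ of the complex anti-de Sitter manifold, then the invariant variable ζ = z₁·z₂ does not lie on the cut [−1, 1]; i.e. it is not a real number with −1 ≤ ζ ≤ 1. -/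
open Finset Complex

/-- The ambient inner product of signature `(+,−,…,−,+)` on `ℝ^{d+1}`:
`x·y = x⁰y⁰ − x¹y¹ − ⋯ − x^{d−1}y^{d−1} + x^d y^d`. -/
noncomputable def adsR (d : ℕ) (x y : Fin (d + 1) → ℝ) : ℝ :=
  x 0 * y 0 + x (Fin.last d) * y (Fin.last d)
    - ∑ i ∈ (Finset.univ.erase 0).erase (Fin.last d), x i * y i

/-- The AdS ambient inner product extended `ℂ`-bilinearly to `ℂ^{d+1}`. -/
noncomputable def adsC (d : ℕ) (x y : Fin (d + 1) → ℂ) : ℂ :=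
  x 0 * y 0 + x (Fin.last d) * y (Fin.last d)
    - ∑ i ∈ (Finset.univ.erase 0).erase (Fin.last d), x i * y i

/-- The chiral tube `𝒵₊` of the complex AdS manifold `{z·z = 1}`:
`y·y > 0` and `ε(z) = sign(y⁰x^d − x⁰y^d) = +1`. -/
def ZPlus (d : ℕ) : Set (Fin (d + 1) → ℂ) :=
  {z | adsC d z z = 1 ∧
    0 < adsR d (fun i => (z i).im) (fun i => (z i).im) ∧
    0 < (z 0).im * (z (Fin.last d)).re - (z 0).re * (z (Fin.last d)).im}

/-- The chiral tube `𝒵₋` of the complex AdS manifold `{z·z = 1}`: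
`y·y > 0` and `ε(z) = sign(y⁰x^d − x⁰y^d) = −1`. -/
def ZMinus (d : ℕ) : Set (Fin (d + 1) → ℂ) :=
  {z | adsC d z z = 1 ∧
    0 < adsR d (fun i => (z i).im) (fun i => (z i).im) ∧
    (z 0).im * (z (Fin.last d)).re - (z 0).re * (z (Fin.last d)).im < 0}

theorem adsR_comm (d : ℕ) (x y : Fin (d + 1) → ℝ) : adsR d x y = adsR d y x := by
  simp only [adsR, mul_comm]

theorem adsR_add_smul_left (d : ℕ) (a b : ℝ) (x y w : Fin (d + 1) → ℝ) :
    adsR d (a • x + b • y) w = a * adsR d x w + b * adsR d y w := by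
  simp only [adsR, Pi.add_apply, Pi.smul_apply, smul_eq_mul, add_mul, Finset.sum_add_distrib,
    mul_assoc, ← Finset.mul_sum]
  ring

theorem adsR_add_smul_right (d : ℕ) (a b : ℝ) (x y w : Fin (d + 1) → ℝ) :
    adsR d w (a • x + b • y) = a * adsR d w x + b * adsR d w y := by
  rw [adsR_comm, adsR_add_smul_left, adsR_comm d x, adsR_comm d y]

theorem adsR_neg_right (d : ℕ) (x y : Fin (d + 1) → ℝ) : adsR d x (-y) = -adsR d x y := by
  simpa using adsR_add_smul_right d (-1) 0 y 0 x

theorem adsR_neg_left (d : ℕ) (x y : Fin (d + 1) → ℝ) : adsR d (-x) y = -adsR d x y := by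
  simpa using adsR_add_smul_left d (-1) 0 x 0 y

theorem adsR_self_nonpos (d : ℕ) (u : Fin (d + 1) → ℝ) (h0 : u 0 = 0)
    (hl : u (Fin.last d) = 0) : adsR d u u ≤ 0 := by
  have := Finset.sum_nonneg fun i (_ : i ∈ (Finset.univ.erase 0).erase (Fin.last d)) =>
    mul_self_nonneg (u i)
  simp only [adsR, h0, hl]
  linarith

theorem adsC_re (d : ℕ) (z w : Fin (d + 1) → ℂ) :
    (adsC d z w).re = adsR d (fun i => (z i).re) (fun i => (w i).re)
      - adsR d (fun i => (z i).im) (fun i => (w i).im) := by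
  simp only [adsC, adsR, sub_re, add_re, mul_re, re_sum, Finset.sum_sub_distrib]
  ring

theorem adsC_im (d : ℕ) (z w : Fin (d + 1) → ℂ) :
    (adsC d z w).im = adsR d (fun i => (z i).re) (fun i => (w i).im)
      + adsR d (fun i => (z i).im) (fun i => (w i).re) := by
  simp only [adsC, adsR, sub_im, add_im, mul_im, im_sum, Finset.sum_add_distrib]
  ring

/-- Two orthogonal vectors of positive square have linearly independent projections
to the plane of the two positive coordinates. -/
theorem chirality_ne_zero (d : ℕ) (x y : Fin (d + 1) → ℝ) (hxy : adsR d x y = 0)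
    (hx : 0 < adsR d x x) (hy : 0 < adsR d y y) :
    y 0 * x (Fin.last d) - x 0 * y (Fin.last d) ≠ 0 := by
  intro he
  have key (a b : ℝ) (h0 : a * x 0 + b * y 0 = 0)
      (hl : a * x (Fin.last d) + b * y (Fin.last d) = 0) : b = 0 := by
    have h := adsR_self_nonpos d (a • x + b • y) (by simpa using h0) (by simpa using hl)
    simp only [adsR_add_smul_left, adsR_add_smul_right, adsR_comm d y x, hxy] at h
    by_contra hb
    have hb2 : 0 < b * b * adsR d y y := mul_pos (mul_self_pos.mpr hb) hy
    have ha2 : 0 ≤ a * a * adsR d x x := mul_nonneg (mul_self_nonneg a) hx.le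
    linarith
  have h0 := key (y 0) (-x 0) (by ring) (by linarith)
  have hl := key (y (Fin.last d)) (-x (Fin.last d)) (by linarith) (by ring)
  have := adsR_self_nonpos d x (by linarith) (by linarith)
  linarith

/-- A real segment between two points of opposite chirality cannot stay in the region where
real and imaginary parts are orthogonal of positive square. -/
theorem false_of_opposite_chirality (d : ℕ) (x₁ y₁ x₂ y₂ : Fin (d + 1) → ℝ) (r : ℝ)
    (hr : -1 ≤ r)
    (hn₁ : adsR d x₁ x₁ - adsR d y₁ y₁ = 1) (ho₁ : adsR d x₁ y₁ = 0) (hy₁ : 0 < adsR d y₁ y₁)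
    (he₁ : y₁ 0 * x₁ (Fin.last d) - x₁ 0 * y₁ (Fin.last d) < 0)
    (hn₂ : adsR d x₂ x₂ - adsR d y₂ y₂ = 1) (ho₂ : adsR d x₂ y₂ = 0) (hy₂ : 0 < adsR d y₂ y₂)
    (he₂ : 0 < y₂ 0 * x₂ (Fin.last d) - x₂ 0 * y₂ (Fin.last d))
    (hre : adsR d x₁ x₂ - adsR d y₁ y₂ = r) (him : adsR d x₁ y₂ + adsR d y₁ x₂ = 0)
    (hyy : 0 ≤ adsR d y₁ y₂) : False := by
  let x (t : ℝ) : Fin (d + 1) → ℝ := (1 - t) • x₁ + t • x₂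
  let y (t : ℝ) : Fin (d + 1) → ℝ := (1 - t) • y₁ + t • y₂
  let e (t : ℝ) : ℝ := y t 0 * x t (Fin.last d) - x t 0 * y t (Fin.last d)
  have hc : Continuous e := by
    simp only [e, x, y, Pi.add_apply, Pi.smul_apply, smul_eq_mul]
    fun_prop
  obtain ⟨t, ⟨ht0, ht1⟩, ht⟩ := intermediate_value_Icc (zero_le_one (α := ℝ)) hc.continuousOn
    (show (0 : ℝ) ∈ Set.Icc (e 0) (e 1) by
      simp only [e, x, y, Pi.add_apply, Pi.smul_apply, smul_eq_mul, Set.mem_Icc]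
      constructor <;> linarith)
  have hs : 0 ≤ 1 - t := by linarith
  have hyt : 0 < adsR d (y t) (y t) := by
    simp only [y, adsR_add_smul_left, adsR_add_smul_right, adsR_comm d y₂ y₁]
    have hcross := mul_nonneg (mul_nonneg hs ht0) hyy
    have h1 := mul_nonneg (mul_self_nonneg (1 - t)) hy₁.le
    have h2 := mul_nonneg (mul_self_nonneg t) hy₂.le
    rcases ht0.eq_or_lt with h | h
    · subst h
      linarith
    · have := mul_pos (mul_pos h h) hy₂
      linarith
  have hxt : 0 < adsR d (x t) (x t) := by
    have hq : adsR d (x t) (x t) - adsR d (y t) (y t)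
        = (1 - t) ^ 2 + t ^ 2 + 2 * ((1 - t) * t) * r := by
      simp only [x, y, adsR_add_smul_left, adsR_add_smul_right, adsR_comm d y₂ y₁,
        adsR_comm d x₂ x₁]
      linear_combination (1 - t) ^ 2 * hn₁ + t ^ 2 * hn₂ + 2 * ((1 - t) * t) * hre
    nlinarith [sq_nonneg (1 - t - t), mul_nonneg (mul_nonneg hs ht0) (by linarith : 0 ≤ r + 1)]
  refine chirality_ne_zero d (x t) (y t) ?_ hxt hyt ht
  simp only [x, y, adsR_add_smul_left, adsR_add_smul_right, adsR_comm d x₂ y₁]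
  linear_combination (1 - t) ^ 2 * ho₁ + t ^ 2 * ho₂ + (1 - t) * t * him

/-- For `z₁ ∈ 𝒵₋` and `z₂ ∈ 𝒵₊`, the invariant variable `ζ = z₁·z₂` avoids the cut
`[−1, 1]`. -/
theorem adS_invariant_variable_avoids_cut (d : ℕ) (hd : 2 ≤ d)
    (z₁ z₂ : Fin (d + 1) → ℂ) (h₁ : z₁ ∈ ZMinus d) (h₂ : z₂ ∈ ZPlus d) :
    ∀ r : ℝ, -1 ≤ r → r ≤ 1 → adsC d z₁ z₂ ≠ (r : ℂ) := by
  intro r hr hr' h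
  obtain ⟨hz₁, hy₁, he₁⟩ := h₁
  obtain ⟨hz₂, hy₂, he₂⟩ := h₂
  have hn₁ := congrArg re hz₁
  have ho₁ := congrArg im hz₁
  have hn₂ := congrArg re hz₂
  have ho₂ := congrArg im hz₂
  have hre := congrArg re h
  have him := congrArg im h
  rw [adsC_re] at hn₁ hn₂ hre
  rw [adsC_im] at ho₁ ho₂ him
  rw [one_re] at hn₁ hn₂
  rw [one_im] at ho₁ ho₂
  rw [ofReal_re] at hre
  rw [ofReal_im] at him
  rw [adsR_comm d (fun i => (z₁ i).im)] at ho₁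
  rw [adsR_comm d (fun i => (z₂ i).im)] at ho₂
  rcases le_total 0 (adsR d (fun i => (z₁ i).im) (fun i => (z₂ i).im)) with hyy | hyy
  · exact false_of_opposite_chirality d _ _ _ _ r hr hn₁ (by linarith) hy₁ he₁
      hn₂ (by linarith) hy₂ he₂ hre him hyy
  · refine false_of_opposite_chirality d _ _ (-fun i => (z₂ i).re) (-fun i => (z₂ i).im) (-r)
      (by linarith) hn₁ (by linarith) hy₁ he₁ ?_ ?_ ?_ ?_ ?_ ?_ ?_ <;>
    simp only [adsR_neg_left, adsR_neg_right, Pi.neg_apply] <;> linarith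
end

section
/- Let ℓ ≥ 0 be an integer and v > 0. Then ∫_{−π/2}^{π/2} (cos φ)^ℓ (cos(φ + iv))^{−(ℓ+1)} dφ = ∫_{−∞}^{∞} (cosh v − i t sinh v)^{−(ℓ+1)} (1 + t²)^{−1/2} dt = 2 ∫₀^{∞} (cosh v + sinh v cosh u)^{−(ℓ+1)} du, where the complex powers are principal branches (well defined since Re cos(φ + iv) = cos φ cosh v > 0 for |φ| < π/2 and Re(cosh v − i t sinh v) = cosh v > 0). The common value equals 2 Q_ℓ(cosh v), twice the Legendre function of the second kind. -/
open Complex MeasureTheory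

/-- The Legendre polynomial `P_ℓ`, via the Rodrigues formula
`P_ℓ(t) = (1/(2^ℓ ℓ!)) dᶫ/dtᶫ (t² − 1)^ℓ`. -/
noncomputable def legendreP (ℓ : ℕ) (t : ℝ) : ℝ :=
  (1 / (2 ^ ℓ * (Nat.factorial ℓ : ℝ))) *
    iteratedDeriv ℓ (fun u : ℝ => (u ^ 2 - 1) ^ ℓ) t

/-- The Legendre function of the second kind `Q_ℓ`, via Neumann's formula
`Q_ℓ(x) = (1/2) ∫_{−1}^{1} P_ℓ(t)/(x − t) dt` (for `x > 1`). -/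
noncomputable def legendreQ (ℓ : ℕ) (x : ℝ) : ℝ :=
  (1 / 2) * ∫ t in (-1 : ℝ)..1, legendreP ℓ t / (x - t)

theorem Complex.integral_horizontal_shift {f : ℂ → ℂ} {g : ℝ → ℝ} {b : ℝ}
    (hf : DifferentiableOn ℂ f {z | z.im ∈ Set.uIcc 0 b})
    (hg : Integrable g) (hg_top : Filter.Tendsto g Filter.atTop (nhds 0))
    (hg_bot : Filter.Tendsto g Filter.atBot (nhds 0))
    (hfg : ∀ x : ℝ, ∀ y ∈ Set.uIcc 0 b, ‖f (x + y * I)‖ ≤ g x) :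
    ∫ x : ℝ, f x = ∫ x : ℝ, f (x + b * I) := by
  have hline : ∀ y ∈ Set.uIcc 0 b, Integrable fun x : ℝ => f (x + y * I) := by
    intro y hy
    have hcont : Continuous fun x : ℝ => f (x + y * I) :=
      hf.continuousOn.comp_continuous (by fun_prop) (by intro x; simpa using hy)
    exact hg.mono' hcont.aestronglyMeasurable (Filter.Eventually.of_forall fun x => hfg x y hy)
  have hvert : ∀ T : ℝ, ‖∫ y in (0 : ℝ)..b, f (T + y * I)‖ ≤ g T * |b| := by
    intro T
    simpa using intervalIntegral.norm_integral_le_of_norm_le_const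
      (fun y hy => hfg T y (Set.uIoc_subset_uIcc hy))
  have hvert_top : Filter.Tendsto (fun T : ℝ => ∫ y in (0 : ℝ)..b, f (T + y * I))
      Filter.atTop (nhds 0) :=
    squeeze_zero_norm hvert (by simpa using hg_top.mul_const |b|)
  have hvert_bot : Filter.Tendsto (fun T : ℝ => ∫ y in (0 : ℝ)..b, f ((-T : ℝ) + y * I))
      Filter.atTop (nhds 0) :=
    squeeze_zero_norm (fun T => hvert (-T))
      (by simpa using (hg_bot.comp Filter.tendsto_neg_atTop_atBot).mul_const |b|)
  have hlim : ∀ y ∈ Set.uIcc 0 b, Filter.Tendsto (fun T : ℝ => ∫ x in (-T)..T, f (x + y * I))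
      Filter.atTop (nhds (∫ x : ℝ, f (x + y * I))) := fun y hy =>
    intervalIntegral_tendsto_integral (hline y hy) Filter.tendsto_neg_atTop_atBot Filter.tendsto_id
  have hrect : ∀ T : ℝ, (∫ x in (-T)..T, f (x + (0 : ℝ) * I)) - (∫ x in (-T)..T, f (x + b * I))
      + I • (∫ y in (0 : ℝ)..b, f (T + y * I))
      - I • (∫ y in (0 : ℝ)..b, f ((-T : ℝ) + y * I)) = 0 := by
    intro T
    have h := integral_boundary_rect_eq_zero_of_differentiableOn f (-T : ℝ) (T + b * I)
      (hf.mono fun z hz => by simpa using hz.2)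
    simpa using h
  have hzero := (((hlim 0 Set.left_mem_uIcc).sub (hlim b Set.right_mem_uIcc)).add
    (hvert_top.const_smul I)).sub (hvert_bot.const_smul I)
  simp only [hrect] at hzero
  have := tendsto_nhds_unique hzero tendsto_const_nhds
  simpa [sub_eq_zero] using this

theorem Real.one_add_sq_le_four_mul_cosh (x : ℝ) : 1 + x ^ 2 ≤ 4 * Real.cosh x := by
  have h := Real.quadratic_le_exp_of_nonneg (abs_nonneg x)
  have h' := Real.exp_pos (-|x|)
  have h'' := abs_nonneg x
  rw [← Real.cosh_abs, Real.cosh_eq]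
  rw [sq_abs] at h
  linarith

theorem Real.integral_range_eq_integral {E : Type*} [NormedAddCommGroup E] [NormedSpace ℝ E]
    {h h' : ℝ → ℝ} (hh : ∀ x, HasDerivAt h (h' x) x) (hinj : Function.Injective h) (g : ℝ → E) :
    ∫ x in Set.range h, g x = ∫ x, |h' x| • g (h x) := by
  simpa using integral_image_eq_integral_abs_deriv_smul MeasurableSet.univ
    (fun x _ => (hh x).hasDerivWithinAt) hinj.injOn g

theorem Complex.cpow_neg_natCast_add_one (z : ℂ) (n : ℕ) :
    z ^ (-((n : ℂ) + 1)) = (z ^ (n + 1))⁻¹ := by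
  rw [cpow_neg]
  exact_mod_cast congrArg _ (cpow_natCast z (n + 1))

theorem sinh_mul_cosh_le_norm {v : ℝ} (hv : 0 < v) {x y : ℝ} (hy : 0 ≤ Real.sin y) :
    Real.sinh v * Real.cosh x ≤
      ‖(Real.cosh v : ℂ) - I * Complex.sinh (x + y * I) * (Real.sinh v : ℂ)‖ := by
  have hs : 0 < Real.sinh v := Real.sinh_pos_iff.2 hv
  have hre : ((Real.cosh v : ℂ) - I * Complex.sinh (x + y * I) * (Real.sinh v : ℂ)) =
      ⟨Real.cosh v + Real.sinh v * (Real.cosh x * Real.sin y),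
        -(Real.sinh v * (Real.sinh x * Real.cos y))⟩ := by
    rw [Complex.sinh_add, Complex.sinh_mul_I, Complex.cosh_mul_I, ← ofReal_sinh, ← ofReal_cosh,
      ← ofReal_sin, ← ofReal_cos]
    apply Complex.ext <;> simp [-ofReal_sinh, -ofReal_cosh, -ofReal_sin, -ofReal_cos] <;> ring
  rw [hre, Complex.norm_eq_sqrt_sq_add_sq]
  apply Real.le_sqrt_of_sq_le
  have h1 := Real.cosh_sq v
  have h2 := Real.cosh_sq x
  have h3 := Real.sin_sq_add_cos_sq y
  have hcx := Real.cosh_pos x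
  have hcv := Real.cosh_pos v
  have h4 : 0 ≤ Real.cosh v * (Real.sinh v * (Real.cosh x * Real.sin y)) := by positivity
  have key : (Real.cosh v + Real.sinh v * (Real.cosh x * Real.sin y)) ^ 2
      + (-(Real.sinh v * (Real.sinh x * Real.cos y))) ^ 2 = (Real.sinh v * Real.cosh x) ^ 2
      + 2 * (Real.cosh v * (Real.sinh v * (Real.cosh x * Real.sin y))) + 1
      + Real.sinh v ^ 2 * Real.sin y ^ 2 := by
    linear_combination h1 + (Real.sinh v ^ 2 * (Real.sin y ^ 2 - 1)) * h2
      + Real.sinh v ^ 2 * Real.sinh x ^ 2 * h3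
  rw [key]
  nlinarith [mul_nonneg (sq_nonneg (Real.sinh v)) (sq_nonneg (Real.sin y))]

theorem integral_cos_pow_mul_cos_cpow_eq (ℓ : ℕ) (v : ℝ) :
    (∫ φ in (-(Real.pi / 2))..(Real.pi / 2),
        ((Real.cos φ : ℂ) ^ ℓ) *
          Complex.cos ((φ : ℂ) + (v : ℂ) * Complex.I) ^ (-((ℓ : ℂ) + 1)))
        = (∫ t : ℝ, ((Real.cosh v : ℂ) - Complex.I * (t : ℂ) * (Real.sinh v : ℂ))
              ^ (-((ℓ : ℂ) + 1)) * ((Real.sqrt (1 + t ^ 2) : ℝ) : ℂ)⁻¹) := by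
  rw [intervalIntegral.integral_of_le (by linarith [Real.pi_pos]), integral_Ioc_eq_integral_Ioo,
    ← Real.range_arctan,
    Real.integral_range_eq_integral Real.hasDerivAt_arctan Real.arctan_injective]
  congr 1
  ext t
  have hr : 0 < 1 + t ^ 2 := by positivity
  obtain ⟨r, hr0, hrr⟩ : ∃ r : ℝ, 0 < r ∧ Real.sqrt (1 + t ^ 2) = r :=
    ⟨_, Real.sqrt_pos.2 hr, rfl⟩
  have hsq : 1 + t ^ 2 = r ^ 2 := by rw [← hrr, Real.sq_sqrt hr.le]
  have hr' : (r : ℂ) ≠ 0 := by exact_mod_cast hr0.ne'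
  have hcos : Complex.cos ((Real.arctan t : ℂ) + v * I) =
      (r : ℂ)⁻¹ * ((Real.cosh v : ℂ) - I * t * Real.sinh v) := by
    rw [Complex.cos_add, Complex.cos_mul_I, Complex.sin_mul_I, ← ofReal_cos, ← ofReal_sin,
      Real.cos_arctan, Real.sin_arctan, hrr]
    push_cast
    field_simp
  rw [hcos, cpow_neg_natCast_add_one, cpow_neg_natCast_add_one, Real.cos_arctan, hrr, hsq,
    abs_of_pos (by positivity), mul_pow, mul_inv, real_smul]
  simp only [one_div, ofReal_inv, ofReal_pow, inv_pow]
  field_simp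
  rw [pow_succ']

theorem integral_cpow_mul_inv_sqrt_eq (ℓ : ℕ) {v : ℝ} (hv : 0 < v) :
    (∫ t : ℝ, ((Real.cosh v : ℂ) - Complex.I * (t : ℂ) * (Real.sinh v : ℂ))
            ^ (-((ℓ : ℂ) + 1)) * ((Real.sqrt (1 + t ^ 2) : ℝ) : ℂ)⁻¹)
        = ((∫ u : ℝ, ((Real.cosh v + Real.sinh v * Real.cosh u) ^ (ℓ + 1))⁻¹ : ℝ) : ℂ) := by
  have hs : 0 < Real.sinh v := Real.sinh_pos_iff.2 hv
  set f : ℂ → ℂ := fun z => (((Real.cosh v : ℂ) - I * Complex.sinh z * Real.sinh v) ^ (ℓ + 1))⁻¹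
    with hf
  have hsin : ∀ y ∈ Set.uIcc 0 (Real.pi / 2), 0 ≤ Real.sin y := by
    intro y hy
    rw [Set.uIcc_of_le (by positivity)] at hy
    exact Real.sin_nonneg_of_nonneg_of_le_pi hy.1 (by linarith [hy.2, Real.pi_pos])
  have hsubst : (∫ t : ℝ, ((Real.cosh v : ℂ) - I * (t : ℂ) * (Real.sinh v : ℂ))
      ^ (-((ℓ : ℂ) + 1)) * ((Real.sqrt (1 + t ^ 2) : ℝ) : ℂ)⁻¹) = ∫ x : ℝ, f x := by
    rw [← setIntegral_univ, ← Real.sinh_surjective.range_eq,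
      Real.integral_range_eq_integral Real.hasDerivAt_sinh Real.sinh_injective]
    congr 1
    ext x
    have hc : (Real.cosh x : ℂ) ≠ 0 := by exact_mod_cast (Real.cosh_pos x).ne'
    rw [cpow_neg_natCast_add_one, ← Real.cosh_sq', Real.sqrt_sq (Real.cosh_pos x).le,
      abs_of_pos (Real.cosh_pos x), real_smul, hf]
    simp only [ofReal_sinh x]
    field_simp
  have hshift : ∀ x : ℝ, f (x + (Real.pi / 2 : ℝ) * I) =
      (((Real.cosh v + Real.sinh v * Real.cosh x) ^ (ℓ + 1))⁻¹ : ℝ) := by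
    intro x
    simp only [hf]
    rw [Complex.sinh_add, Complex.sinh_mul_I, Complex.cosh_mul_I, ← ofReal_sin, ← ofReal_cos,
      Real.sin_pi_div_two, Real.cos_pi_div_two]
    push_cast
    congr 2
    linear_combination -(Complex.cosh x * Complex.sinh v) * I_sq
  have hg : ∀ x : ℝ, ∀ y ∈ Set.uIcc 0 (Real.pi / 2),
      ‖f (x + y * I)‖ ≤ 4 * (Real.sinh v ^ (ℓ + 1))⁻¹ * (1 + x ^ 2)⁻¹ := by
    intro x y hy
    have hle := sinh_mul_cosh_le_norm hv (x := x) (hsin y hy)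
    have hcx := Real.one_le_cosh x
    have hlow : Real.sinh v ^ (ℓ + 1) * ((1 + x ^ 2) / 4) ≤
        ‖(Real.cosh v : ℂ) - I * Complex.sinh (x + y * I) * (Real.sinh v : ℂ)‖ ^ (ℓ + 1) :=
      calc Real.sinh v ^ (ℓ + 1) * ((1 + x ^ 2) / 4)
          ≤ Real.sinh v ^ (ℓ + 1) * Real.cosh x := by
            gcongr
            linarith [Real.one_add_sq_le_four_mul_cosh x]
        _ ≤ Real.sinh v ^ (ℓ + 1) * Real.cosh x ^ (ℓ + 1) := by
            gcongr
            exact le_self_pow₀ hcx (by simp)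
        _ = (Real.sinh v * Real.cosh x) ^ (ℓ + 1) := (mul_pow _ _ _).symm
        _ ≤ _ := by gcongr
    simp only [hf, norm_inv, norm_pow]
    calc _ ≤ (Real.sinh v ^ (ℓ + 1) * ((1 + x ^ 2) / 4))⁻¹ := inv_anti₀ (by positivity) hlow
      _ = _ := by field_simp
  have hne : ∀ z : ℂ, z.im ∈ Set.uIcc 0 (Real.pi / 2) →
      (Real.cosh v : ℂ) - I * Complex.sinh z * Real.sinh v ≠ 0 := by
    intro z hz
    have hle := sinh_mul_cosh_le_norm hv (x := z.re) (hsin z.im hz)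
    rw [re_add_im] at hle
    exact norm_pos_iff.1 ((mul_pos hs (Real.cosh_pos _)).trans_le hle)
  have hdiff : DifferentiableOn ℂ f {z | z.im ∈ Set.uIcc 0 (Real.pi / 2)} := by
    refine DifferentiableOn.inv (Differentiable.differentiableOn ?_)
      fun z hz => pow_ne_zero _ (hne z hz)
    exact ((differentiable_const _).sub
      ((Complex.differentiable_sinh.const_mul I).mul_const _)).pow _
  have htop : Filter.Tendsto (fun x : ℝ => (1 + x ^ 2)⁻¹) Filter.atTop (nhds 0) :=
    (Filter.tendsto_atTop_add_const_left _ 1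
      (Filter.tendsto_pow_atTop two_ne_zero)).inv_tendsto_atTop
  have hbot : Filter.Tendsto (fun x : ℝ => (1 + x ^ 2)⁻¹) Filter.atBot (nhds 0) := by
    simpa [Function.comp_def] using htop.comp Filter.tendsto_neg_atBot_atTop
  rw [hsubst, integral_horizontal_shift hdiff
    (integrable_inv_one_add_sq.const_mul (4 * (Real.sinh v ^ (ℓ + 1))⁻¹))
    (by simpa using htop.const_mul (4 * (Real.sinh v ^ (ℓ + 1))⁻¹))
    (by simpa using hbot.const_mul (4 * (Real.sinh v ^ (ℓ + 1))⁻¹)) hg]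
  simp only [hshift]
  exact integral_ofReal

theorem two_mul_integral_Ioi_cpow_eq (ℓ : ℕ) (v : ℝ) :
    (2 * ∫ u in Set.Ioi (0 : ℝ),
            ((Real.cosh v + Real.sinh v * Real.cosh u : ℝ) : ℂ) ^ (-((ℓ : ℂ) + 1)))
        = ((∫ u : ℝ, ((Real.cosh v + Real.sinh v * Real.cosh u) ^ (ℓ + 1))⁻¹ : ℝ) : ℂ) := by
  have habs := integral_comp_abs
    (f := fun u => ((Real.cosh v + Real.sinh v * Real.cosh u) ^ (ℓ + 1))⁻¹)
  simp only [Real.cosh_abs] at habs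
  rw [habs, ofReal_mul, ← integral_complex_ofReal]
  simp only [cpow_neg_natCast_add_one]
  push_cast
  rfl

theorem integral_derivative_mul_inv_pow {p : Polynomial ℝ} (h₁ : p.eval 1 = 0)
    (h₂ : p.eval (-1) = 0) {x : ℝ} (hx : 1 < x) (k : ℕ) :
    ∫ t in (-1 : ℝ)..1, p.derivative.eval t * ((x - t) ^ (k + 1))⁻¹ =
      -((k + 1 : ℕ) * ∫ t in (-1 : ℝ)..1, p.eval t * ((x - t) ^ (k + 2))⁻¹) := by
  have hpos : ∀ t ∈ Set.uIcc (-1 : ℝ) 1, x - t ≠ 0 := by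
    intro t ht
    rw [Set.uIcc_of_le (by norm_num)] at ht
    linarith [ht.2]
  have hderiv : ∀ t ∈ Set.uIcc (-1 : ℝ) 1, HasDerivAt (fun t => ((x - t) ^ (k + 1))⁻¹)
      ((k + 1 : ℕ) * ((x - t) ^ (k + 2))⁻¹) t := by
    intro t ht
    have hne := hpos t ht
    refine ((((hasDerivAt_id t).const_sub x).pow (k + 1)).inv
      (pow_ne_zero _ hne)).congr_deriv ?_
    simp only [id, Pi.pow_apply, Nat.add_sub_cancel]
    field_simp
    ring
  have h := intervalIntegral.integral_mul_deriv_eq_deriv_mul hderiv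
    (fun t _ => p.hasDerivAt t)
    (ContinuousOn.intervalIntegrable (continuousOn_const.mul
      (ContinuousOn.inv₀ (by fun_prop) fun t ht => pow_ne_zero _ (hpos t ht))))
    (p.derivative.continuous.intervalIntegrable _ _)
  simp only [h₁, h₂, mul_zero, sub_zero, zero_sub] at h
  rw [← intervalIntegral.integral_const_mul]
  simp only [mul_comm _ (((_ : ℝ) ^ _)⁻¹), mul_assoc, mul_left_comm] at h ⊢
  exact h

theorem integral_iterate_derivative_mul_inv_pow {p : Polynomial ℝ} {x : ℝ} (hx : 1 < x) (n : ℕ)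
    (h₁ : ∀ i < n, (Polynomial.derivative^[i] p).eval 1 = 0)
    (h₂ : ∀ i < n, (Polynomial.derivative^[i] p).eval (-1) = 0) (k : ℕ) :
    (k.factorial : ℝ) *
        ∫ t in (-1 : ℝ)..1, (Polynomial.derivative^[n] p).eval t * ((x - t) ^ (k + 1))⁻¹ =
      (-1) ^ n * (k + n).factorial *
        ∫ t in (-1 : ℝ)..1, p.eval t * ((x - t) ^ (k + n + 1))⁻¹ := by
  induction n generalizing k with
  | zero => simp
  | succ n ih =>
    have ih' := ih (fun i hi => h₁ i (by omega)) (fun i hi => h₂ i (by omega)) (k + 1)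
    rw [Function.iterate_succ_apply',
      integral_derivative_mul_inv_pow (h₁ n n.lt_succ_self) (h₂ n n.lt_succ_self) hx]
    rw [Nat.factorial_succ k, show k + 1 + n = k + (n + 1) by ring] at ih'
    push_cast at ih' ⊢
    linear_combination -ih'

theorem iteratedDeriv_polynomial_eval (p : Polynomial ℝ) (n : ℕ) :
    iteratedDeriv n (fun t => p.eval t) = fun t => (Polynomial.derivative^[n] p).eval t := by
  induction n with
  | zero => simp
  | succ n ih =>
    ext t
    rw [iteratedDeriv_succ, ih, Polynomial.deriv, Function.iterate_succ_apply']

theorem legendreQ_eq_integral (ℓ : ℕ) {x : ℝ} (hx : 1 < x) :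
    2 * legendreQ ℓ x =
      (2 ^ ℓ)⁻¹ * ∫ t in (-1 : ℝ)..1, (1 - t ^ 2) ^ ℓ * ((x - t) ^ (ℓ + 1))⁻¹ := by
  set p : Polynomial ℝ := (Polynomial.X ^ 2 - 1) ^ ℓ with hp
  have hvanish : ∀ a : ℝ, a ^ 2 = 1 → ∀ i < ℓ, (Polynomial.derivative^[i] p).eval a = 0 := by
    intro a ha i hi
    obtain ⟨q, hq⟩ :=
      Polynomial.pow_sub_dvd_iterate_derivative_pow (Polynomial.X ^ 2 - 1 : Polynomial ℝ) ℓ i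
    rw [hp, hq]
    simp [ha, show ℓ - i ≠ 0 by omega]
  have hparts := integral_iterate_derivative_mul_inv_pow hx ℓ (hvanish 1 (by norm_num))
    (hvanish (-1) (by norm_num)) 0
  have hP : ∀ t, legendreP ℓ t / (x - t) = (1 / (2 ^ ℓ * (ℓ.factorial : ℝ))) *
      ((Polynomial.derivative^[ℓ] p).eval t * ((x - t) ^ (0 + 1))⁻¹) := by
    intro t
    have := congrFun (iteratedDeriv_polynomial_eval p ℓ) t
    simp only [hp, Polynomial.eval_pow, Polynomial.eval_sub, Polynomial.eval_X,
      Polynomial.eval_one] at this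
    rw [legendreP, this]
    simp [hp, div_eq_mul_inv, mul_assoc]
  have hsign : ∀ t : ℝ, p.eval t * ((x - t) ^ (0 + ℓ + 1))⁻¹ =
      (-1) ^ ℓ * ((1 - t ^ 2) ^ ℓ * ((x - t) ^ (ℓ + 1))⁻¹) := by
    intro t
    rw [← mul_assoc, ← mul_pow]
    simp [hp]
  simp only [hsign, intervalIntegral.integral_const_mul] at hparts
  simp only [legendreQ, hP, intervalIntegral.integral_const_mul]
  have hsq : ((-1 : ℝ) ^ ℓ) * (-1) ^ ℓ = 1 := by rw [← mul_pow]; simp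
  have hfac : (ℓ.factorial : ℝ) ≠ 0 := by exact_mod_cast ℓ.factorial_ne_zero
  simp only [Nat.factorial_zero, Nat.cast_one, one_mul, zero_add] at hparts ⊢
  rw [hparts]
  field_simp
  linear_combination (∫ t in (-1 : ℝ)..1, (1 - t ^ 2) ^ ℓ / (x - t) ^ (ℓ + 1)) * hsq

theorem range_mul_exp_sub_one_div_add_one {a : ℝ} (ha : 0 < a) :
    Set.range (fun u => (a * Real.exp u - 1) / (a * Real.exp u + 1)) = Set.Ioo (-1) 1 := by
  ext t
  constructor
  · rintro ⟨u, rfl⟩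
    have := mul_pos ha (Real.exp_pos u)
    constructor
    · rw [lt_div_iff₀ (by positivity)]; linarith
    · rw [div_lt_iff₀ (by positivity)]; linarith
  · rintro ⟨h₁, h₂⟩
    have h₁' : 0 < 1 + t := by linarith
    have h₂' : 0 < 1 - t := by linarith
    refine ⟨Real.log ((1 + t) / (1 - t) / a), ?_⟩
    simp only
    rw [Real.exp_log (by positivity)]
    field_simp
    ring

theorem integral_inv_pow_eq_two_mul_legendreQ (ℓ : ℕ) {v : ℝ} (hv : 0 < v) :
    ∫ u : ℝ, ((Real.cosh v + Real.sinh v * Real.cosh u) ^ (ℓ + 1))⁻¹ =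
      2 * legendreQ ℓ (Real.cosh v) := by
  have hs : 0 < Real.sinh v := Real.sinh_pos_iff.2 hv
  have hc : 1 < Real.cosh v := Real.one_lt_cosh.2 hv.ne'
  have hcs := Real.cosh_sq v
  rw [legendreQ_eq_integral ℓ hc]
  generalize Real.sinh v = s at *
  generalize Real.cosh v = c at *
  set a : ℝ := (c + 1) / s with ha_def
  have ha : 0 < a := by positivity
  have hderiv : ∀ u, HasDerivAt (fun u => (a * Real.exp u - 1) / (a * Real.exp u + 1))
      (2 * (a * Real.exp u) / (a * Real.exp u + 1) ^ 2) u := by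
    intro u
    have := mul_pos ha (Real.exp_pos u)
    have he := (Real.hasDerivAt_exp u).const_mul a
    refine ((he.sub_const 1).div (he.add_const 1) (by positivity)).congr_deriv ?_
    ring
  have hinj : Function.Injective (fun u => (a * Real.exp u - 1) / (a * Real.exp u + 1)) := by
    intro u w huw
    have hu := mul_pos ha (Real.exp_pos u)
    have hw := mul_pos ha (Real.exp_pos w)
    simp only at huw
    rw [div_eq_div_iff (by positivity) (by positivity)] at huw
    exact Real.exp_injective (mul_left_cancel₀ ha.ne' (by linarith))
  rw [intervalIntegral.integral_of_le (by norm_num), integral_Ioc_eq_integral_Ioo,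
    ← range_mul_exp_sub_one_div_add_one ha, Real.integral_range_eq_integral hderiv hinj,
    ← integral_const_mul]
  congr 1
  ext u
  have he := Real.exp_pos u
  rw [Real.cosh_eq, Real.exp_neg]
  generalize Real.exp u = e at *
  obtain ⟨y, hy⟩ : ∃ y, y = a * e := ⟨_, rfl⟩
  have hy0 : 0 < y := hy ▸ mul_pos ha he
  have hD : c + s * ((e + e⁻¹) / 2) = ((c - 1) * y + c + 1) * (y + 1) / (2 * y) := by
    rw [hy, ha_def]
    field_simp
    linear_combination -(e ^ 2 * (c + 1)) * hcs
  have hnum : 1 - ((y - 1) / (y + 1)) ^ 2 = 4 * y / (y + 1) ^ 2 := by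
    field_simp
    ring
  have hden : c - (y - 1) / (y + 1) = ((c - 1) * y + c + 1) / (y + 1) := by
    field_simp
    ring
  have hpos : 0 < (c - 1) * y + c + 1 := by nlinarith
  rw [hD, ← hy, hnum, hden, abs_of_pos (by positivity), smul_eq_mul]
  generalize (c - 1) * y + c + 1 = d at *
  rw [show (4 : ℝ) = 2 * 2 by norm_num]
  simp only [div_pow, mul_pow, inv_div, ← pow_mul]
  field_simp
  ring

/-- The chain of integral identities evaluating the plane-wave representation of the
`AdS₂` Klein–Gordon two-point function:
`∫_{−π/2}^{π/2} (cos φ)^ℓ (cos(φ+iv))^{−ℓ−1} dφ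
  = ∫_ℝ (cosh v − it sinh v)^{−ℓ−1} (1+t²)^{−1/2} dt
  = 2∫₀^∞ (cosh v + sinh v cosh u)^{−ℓ−1} du = 2 Q_ℓ(cosh v)`. -/
theorem adS2_plane_wave_integrals (ℓ : ℕ) (v : ℝ) (hv : 0 < v) :
    (∫ φ in (-(Real.pi / 2))..(Real.pi / 2),
        ((Real.cos φ : ℂ) ^ ℓ) *
          Complex.cos ((φ : ℂ) + (v : ℂ) * Complex.I) ^ (-((ℓ : ℂ) + 1)))
        = (∫ t : ℝ, ((Real.cosh v : ℂ) - Complex.I * (t : ℂ) * (Real.sinh v : ℂ))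
              ^ (-((ℓ : ℂ) + 1)) * ((Real.sqrt (1 + t ^ 2) : ℝ) : ℂ)⁻¹) ∧
      (∫ t : ℝ, ((Real.cosh v : ℂ) - Complex.I * (t : ℂ) * (Real.sinh v : ℂ))
            ^ (-((ℓ : ℂ) + 1)) * ((Real.sqrt (1 + t ^ 2) : ℝ) : ℂ)⁻¹)
        = 2 * ∫ u in Set.Ioi (0 : ℝ),
            ((Real.cosh v + Real.sinh v * Real.cosh u : ℝ) : ℂ) ^ (-((ℓ : ℂ) + 1)) ∧
      (2 * ∫ u in Set.Ioi (0 : ℝ),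
            ((Real.cosh v + Real.sinh v * Real.cosh u : ℝ) : ℂ) ^ (-((ℓ : ℂ) + 1)))
        = 2 * ((legendreQ ℓ (Real.cosh v) : ℝ) : ℂ) := by
  refine ⟨integral_cos_pow_mul_cos_cpow_eq ℓ v, ?_, ?_⟩
  · rw [integral_cpow_mul_inv_sqrt_eq ℓ hv, two_mul_integral_Ioi_cpow_eq]
  · rw [two_mul_integral_Ioi_cpow_eq, integral_inv_pow_eq_two_mul_legendreQ ℓ hv]
    push_cast
    rfl
end
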